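/- arXiv:2107.01234 — 5 statements merged into one kernel-verified Lean document; each statement's English description precedes it below -/
import Mathlib

section
/- Let N ≥ 1 and let a_1, …, a_N be positive integers such that M(a_1)·M(a_2)···M(a_N) = ε·Id with ε ∈ {1, −1}. Then there exists a non-negative integer k with 3(k+1) ≤ N such that a_1 + a_2 + ⋯ + a_N = 3(N−2) − 6k, and moreover ε = (−1)^{k+1}. -/
/-- The matrix `M(a)` with first row `(a, -1)` and second row `(1, 0)`. -/
def M (a : ℤ) : Matrix (Fin 2) (Fin 2) ℤ := !![a, -1; 1, 0]

/-- `l` is a positive solution of `M(a_1) ⋯ M(a_N) = ε • 1`. -/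
def IsPosSolution (ε : ℤ) (l : List ℤ) : Prop :=
  (∀ x ∈ l, 0 < x) ∧ (l.map M).prod = ε • (1 : Matrix (Fin 2) (Fin 2) ℤ)

/-- The total sum of `l` and the sign `ε` have the form predicted by the quiddity formula. -/
def HasQuidditySum (ε : ℤ) (l : List ℤ) : Prop :=
  ∃ k : ℕ, 3 * (k + 1) ≤ l.length ∧
    l.sum = 3 * ((l.length : ℤ) - 2) - 6 * k ∧ ε = (-1) ^ (k + 1)

theorem IsPosSolution.rotate {ε : ℤ} (hε : ε = 1 ∨ ε = -1) {s t : List ℤ}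
    (h : IsPosSolution ε (s ++ t)) : IsPosSolution ε (t ++ s) := by
  obtain ⟨hpos, hprod⟩ := h
  refine ⟨fun x hx => hpos x (by simpa [or_comm] using hx), ?_⟩
  rw [List.map_append, List.prod_append] at hprod ⊢
  rcases hε with rfl | rfl
  · rw [one_smul] at hprod ⊢
    exact mul_eq_one_comm.mp hprod
  · rw [neg_one_smul] at hprod ⊢
    rw [← neg_eq_iff_eq_neg, ← neg_mul] at hprod
    rw [← neg_eq_iff_eq_neg, ← mul_neg]
    exact mul_eq_one_comm.mp hprod

theorem HasQuidditySum.rotate {ε : ℤ} {s t : List ℤ}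
    (h : HasQuidditySum ε (s ++ t)) : HasQuidditySum ε (t ++ s) := by
  obtain ⟨k, h1, h2, h3⟩ := h
  simp only [List.length_append, List.sum_append] at h1 h2
  refine ⟨k, ?_, ?_, h3⟩ <;> simp only [List.length_append, List.sum_append]
  · omega
  · push_cast at h2 ⊢
    linarith

theorem M_mul_apply_zero_zero (a : ℤ) (P : Matrix (Fin 2) (Fin 2) ℤ) :
    (M a * P) 0 0 = a * P 0 0 - P 1 0 := by
  simp [M, Matrix.mul_apply, Fin.sum_univ_two, sub_eq_add_neg]

theorem M_mul_apply_one_zero (a : ℤ) (P : Matrix (Fin 2) (Fin 2) ℤ) :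
    (M a * P) 1 0 = P 0 0 := by
  simp [M, Matrix.mul_apply, Fin.sum_univ_two]

theorem M_mul_M_one_mul_M (a b : ℤ) : M a * M 1 * M b = M (a - 1) * M (b - 1) := by
  ext i j
  fin_cases i <;> fin_cases j <;> simp [M, Matrix.mul_apply, Fin.sum_univ_two]
  all_goals ring

theorem M_mul_M_one_mul_M_one_mul_M (a b : ℤ) :
    M a * M 1 * M 1 * M b = -M (a + b - 1) := by
  ext i j
  fin_cases i <;> fin_cases j <;> simp [M, Matrix.mul_apply, Fin.sum_univ_two]
  ring

theorem prod_map_M_first_column {l : List ℤ} (h : ∀ x ∈ l, 2 ≤ x) :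
    0 ≤ (l.map M).prod 1 0 ∧ (l.map M).prod 1 0 < (l.map M).prod 0 0 := by
  induction l with
  | nil => simp
  | cons a l ih =>
    obtain ⟨h1, h2⟩ := ih fun x hx => h x (List.mem_cons_of_mem _ hx)
    have ha := h a List.mem_cons_self
    rw [List.map_cons, List.prod_cons, M_mul_apply_zero_zero, M_mul_apply_one_zero]
    constructor
    · omega
    · nlinarith

theorem IsPosSolution.one_mem {ε : ℤ} {l : List ℤ} (hl : l ≠ [])
    (h : IsPosSolution ε l) : 1 ∈ l := by
  by_contra h1
  have h2 : ∀ x ∈ l, 2 ≤ x := fun x hx => by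
    have := h.1 x hx
    have : x ≠ 1 := fun e => h1 (e ▸ hx)
    omega
  obtain ⟨a, t, rfl⟩ := List.exists_cons_of_ne_nil hl
  have ht := prod_map_M_first_column fun x hx => h2 x (List.mem_cons_of_mem _ hx)
  have hz := congrFun (congrFun h.2 1) 0
  rw [List.map_cons, List.prod_cons, M_mul_apply_one_zero] at hz
  simp at hz
  omega

/-- The quiddity formula for solutions containing two adjacent ones, given it for shorter ones. -/
theorem IsPosSolution.hasQuidditySum_of_adjacent_ones {ε a : ℤ} (hε : ε = 1 ∨ ε = -1)
    {u : List ℤ}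
    (ih : ∀ l : List ℤ, l.length < (a :: 1 :: 1 :: u).length → l ≠ [] →
      ∀ δ : ℤ, (δ = 1 ∨ δ = -1) → IsPosSolution δ l → HasQuidditySum δ l)
    (h : IsPosSolution ε (a :: 1 :: 1 :: u)) : HasQuidditySum ε (a :: 1 :: 1 :: u) := by
  obtain ⟨hpos, hprod⟩ := h
  have ha := hpos a (by simp)
  rcases u with _ | ⟨c, v⟩
  · have e10 := congrFun (congrFun hprod 0) 1
    have e11 := congrFun (congrFun hprod 1) 1
    simp [M, Matrix.mul_apply, Fin.sum_univ_two] at e10 e11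
    refine ⟨0, by simp, ?_, ?_⟩
    · simp
      omega
    · simp
      omega
  · have hc := hpos c (by simp)
    obtain ⟨k, h1, h2, h3⟩ := ih ((a + c - 1) :: v) (by simp) (by simp) (-ε) (by omega) (by
      refine ⟨?_, ?_⟩
      · intro x hx
        rcases List.mem_cons.mp hx with rfl | hx
        · omega
        · exact hpos x (by simp [hx])
      · simp only [List.map_cons, List.prod_cons, ← mul_assoc] at hprod ⊢
        rw [M_mul_M_one_mul_M_one_mul_M] at hprod
        rw [neg_smul, ← hprod, neg_mul, neg_neg])
    simp only [List.length_cons, List.sum_cons] at h1 h2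
    refine ⟨k + 1, ?_, ?_, ?_⟩
    · simp only [List.length_cons]
      omega
    · simp only [List.length_cons, List.sum_cons]
      push_cast at h2 ⊢
      linarith
    · rw [pow_succ, ← h3]
      ring

theorem IsPosSolution.hasQuidditySum {ε : ℤ} (hε : ε = 1 ∨ ε = -1) {l : List ℤ}
    (hl : l ≠ []) (h : IsPosSolution ε l) : HasQuidditySum ε l := by
  induction hn : l.length using Nat.strong_induction_on generalizing l ε with
  | _ n ih =>
  subst hn
  replace ih : ∀ m : List ℤ, m.length < l.length → m ≠ [] →
      ∀ δ : ℤ, (δ = 1 ∨ δ = -1) → IsPosSolution δ m → HasQuidditySum δ m :=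
    fun m hm hm0 δ hδ hs => ih m.length hm hδ hm0 hs rfl
  obtain ⟨s, t, rfl⟩ := List.append_of_mem (h.one_mem hl)
  refine HasQuidditySum.rotate (s := 1 :: t) ?_
  replace h := h.rotate hε
  have hlen : (s ++ 1 :: t).length = (t ++ s).length + 1 := by
    simp only [List.length_append, List.length_cons]
    omega
  rw [hlen] at ih
  rw [List.cons_append] at h ⊢
  generalize t ++ s = w at h ih ⊢
  rcases w with _ | ⟨b, w⟩
  · have := congrFun (congrFun h.2 1) 0
    simp [M] at this
  rcases List.eq_nil_or_concat' w with rfl | ⟨u, a, rfl⟩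
  · have := congrFun (congrFun h.2 0) 1
    simp [M, Matrix.mul_apply, Fin.sum_univ_two] at this
  have ha := h.1 a (by simp)
  have hb := h.1 b (by simp)
  refine HasQuidditySum.rotate (s := [a]) (t := 1 :: b :: u) ?_
  replace h : IsPosSolution ε (a :: 1 :: b :: u) :=
    IsPosSolution.rotate hε (s := 1 :: b :: u) (t := [a]) h
  change HasQuidditySum ε (a :: 1 :: b :: u)
  by_cases hb1 : b = 1
  · subst hb1
    exact h.hasQuidditySum_of_adjacent_ones hε (by simpa using ih)
  by_cases ha1 : a = 1
  · subst ha1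
    rcases List.eq_nil_or_concat' (b :: u) with h0 | ⟨v, c, hv⟩
    · simp at h0
    have hlv := congrArg List.length hv
    rw [hv] at h ⊢
    refine HasQuidditySum.rotate (s := [c]) (t := 1 :: 1 :: v) ?_
    replace h : IsPosSolution ε (c :: 1 :: 1 :: v) :=
      IsPosSolution.rotate hε (s := 1 :: 1 :: v) (t := [c]) h
    refine h.hasQuidditySum_of_adjacent_ones hε fun m hm => ih m ?_
    simp at hm hlv ⊢
    omega
  obtain ⟨k, h1, h2, h3⟩ := ih ((a - 1) :: (b - 1) :: u) (by simp) (by simp) ε hε (by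
    refine ⟨?_, ?_⟩
    · intro x hx
      rcases List.mem_cons.mp hx with rfl | hx
      · omega
      rcases List.mem_cons.mp hx with rfl | hx
      · omega
      · exact h.1 x (by simp [hx])
    · have hprod := h.2
      simp only [List.map_cons, List.prod_cons, ← mul_assoc] at hprod ⊢
      rwa [M_mul_M_one_mul_M] at hprod)
  simp only [List.length_cons, List.sum_cons] at h1 h2
  refine ⟨k, ?_, ?_, h3⟩ <;> simp only [List.length_cons, List.sum_cons]
  · omega
  · push_cast at h2 ⊢
    linarith

theorem stmt0 (N : ℕ) (hN : 1 ≤ N) (a : Fin N → ℤ) (ha : ∀ i, 0 < a i)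
    (ε : ℤ) (hε : ε = 1 ∨ ε = -1)
    (hprod : (List.ofFn fun i => M (a i)).prod = ε • (1 : Matrix (Fin 2) (Fin 2) ℤ)) :
    ∃ k : ℕ, 3 * (k + 1) ≤ N ∧
      (∑ i, a i) = 3 * ((N : ℤ) - 2) - 6 * k ∧ ε = (-1) ^ (k + 1) := by
  have hsol : IsPosSolution ε (List.ofFn a) := by
    refine ⟨?_, ?_⟩
    · intro x hx
      obtain ⟨i, rfl⟩ := (List.mem_ofFn' a x).mp hx
      exact ha i
    · rw [List.map_ofFn]
      exact hprod
  have hne : List.ofFn a ≠ [] := by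
    rw [Ne, List.ofFn_eq_nil_iff]
    omega
  simpa [HasQuidditySum, List.sum_ofFn] using hsol.hasQuidditySum hε hne
end

section
/- For every integer n ≥ 1, the number of tuples (a_1, …, a_{n+2}) of positive integers satisfying M(a_1)·M(a_2)···M(a_{n+2}) = Id or −Id equals Σ_{0 ≤ k < n/3} Σ_{s=0}^{k} ((3(k−s)+2)/(n−s+1)) · C(n−3k+s−2, s) · C(2n−3k−s−1, n−3k−1), where the outer sum is over integers k with 0 ≤ 3k < n. -/
/-- Binomial coefficient `C(a, b)` for an integer `a`, with the conventions
`C(a, b) = 0` for `0 ≤ a < b`, and `C(a, 0) = 1` for every integer `a`. -/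
def Cq (a : ℤ) (b : ℕ) : ℚ :=
  if 0 ≤ a then (a.toNat.choose b : ℚ) else if b = 0 then 1 else 0

/-- `1` or `-1`: the matrices that are trivial in `PSL₂(ℤ)`. -/
def IsPMOne (g : Matrix (Fin 2) (Fin 2) ℤ) : Prop := g = 1 ∨ g = -1

instance (g : Matrix (Fin 2) (Fin 2) ℤ) : Decidable (IsPMOne g) :=
  inferInstanceAs (Decidable (g = 1 ∨ g = -1))

theorem isPMOne_neg (g : Matrix (Fin 2) (Fin 2) ℤ) : IsPMOne (-g) ↔ IsPMOne g := by
  unfold IsPMOne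
  rw [neg_inj, neg_eq_iff_eq_neg, or_comm]

/-- The number of ways to multiply `g` on the right by `L` factors, `N` of them equal to `M 1` and
the others to `(M 0)⁻¹ * M 1`, with result `1` or `-1`. -/
def gapCount : ℕ → ℕ → Matrix (Fin 2) (Fin 2) ℤ → ℕ
  | 0, N, g => if N = 0 ∧ IsPMOne g then 1 else 0
  | L + 1, 0, g => gapCount L 0 (g * !![1, 0; -1, 1])
  | L + 1, N + 1, g => gapCount L N (g * M 1) + gapCount L (N + 1) (g * !![1, 0; -1, 1])

/-- Positive integer lists of length `N + 1` and sum `L + 1` whose product of matrices `M` is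
inverse to `g` up to sign. -/
def solutionLists (g : Matrix (Fin 2) (Fin 2) ℤ) (L N : ℕ) : Set (List ℤ) :=
  {l | l.length = N + 1 ∧ (∀ a ∈ l, 0 < a) ∧ l.sum = L + 1 ∧ IsPMOne (g * (l.map M).prod)}

theorem length_le_sum_of_pos (l : List ℤ) (h : ∀ a ∈ l, 0 < a) : (l.length : ℤ) ≤ l.sum := by
  induction l with
  | nil => simp
  | cons a t ih =>
    have h1 := h a (by simp)
    have h2 := ih fun b hb => h b (by simp [hb])
    simp only [List.length_cons, List.sum_cons]
    push_cast
    omega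

theorem shift_mul_M (x : ℤ) : !![1, 1; 0, 1] * M x = M (x + 1) := by
  simp [M, add_comm]

theorem shift_mul_M_one : !![1, 1; 0, 1] * M 1 = M 1 * !![1, 0; -1, 1] := by
  simp [M]

theorem solutionLists_zero (g : Matrix (Fin 2) (Fin 2) ℤ) (N : ℕ) :
    solutionLists g 0 N = if N = 0 ∧ IsPMOne (g * M 1) then {[1]} else ∅ := by
  ext l
  have key : l ∈ solutionLists g 0 N ↔ l = [1] ∧ N = 0 ∧ IsPMOne (g * M 1) := by
    constructor
    · rintro ⟨h1, h2, h3, h4⟩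
      have h5 := length_le_sum_of_pos l h2
      have hN : N = 0 := by omega
      subst hN
      obtain ⟨a, rfl⟩ := List.length_eq_one_iff.1 h1
      obtain rfl : a = 1 := by simpa using h3
      exact ⟨rfl, rfl, by simpa using h4⟩
    · rintro ⟨rfl, rfl, h⟩
      exact ⟨by simp, by simp, by simp, by simpa using h⟩
  rw [key]
  split_ifs with h <;> simp [h]

theorem cons_succ_mem_solutionLists (g : Matrix (Fin 2) (Fin 2) ℤ) (L N : ℕ) (x : ℤ)
    (hx : 0 < x) (t : List ℤ) :
    (x + 1) :: t ∈ solutionLists g (L + 1) N ↔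
      x :: t ∈ solutionLists (g * !![1, 1; 0, 1]) L N := by
  simp only [solutionLists, Set.mem_ofPred_eq, List.length_cons, List.mem_cons, forall_eq_or_imp,
    List.sum_cons, List.map_cons, List.prod_cons, ← shift_mul_M, Matrix.mul_assoc]
  have h1 : 0 < x + 1 := by omega
  have h2 : x + 1 + t.sum = ((L + 1 : ℕ) : ℤ) + 1 ↔ x + t.sum = (L : ℤ) + 1 := by
    push_cast
    omega
  rw [h2]
  simp only [hx, h1, true_and]

theorem one_cons_mem_solutionLists (g : Matrix (Fin 2) (Fin 2) ℤ) (L N : ℕ) (t : List ℤ) :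
    1 :: t ∈ solutionLists g (L + 1) (N + 1) ↔ t ∈ solutionLists (g * M 1) L N := by
  simp only [solutionLists, Set.mem_ofPred_eq, List.length_cons, List.mem_cons, forall_eq_or_imp,
    List.sum_cons, List.map_cons, List.prod_cons, Matrix.mul_assoc]
  have h2 : 1 + t.sum = ((L + 1 : ℕ) : ℤ) + 1 ↔ t.sum = (L : ℤ) + 1 := by
    push_cast
    omega
  rw [h2]
  simp

theorem one_cons_notMem_solutionLists (g : Matrix (Fin 2) (Fin 2) ℤ) (L : ℕ) (t : List ℤ) :
    1 :: t ∉ solutionLists g (L + 1) 0 := by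
  rintro ⟨h1, -, h3, -⟩
  obtain rfl : t = [] := by simpa using h1
  simp at h3
  omega

theorem exists_cons_of_mem_solutionLists {g : Matrix (Fin 2) (Fin 2) ℤ} {L N : ℕ} {l : List ℤ}
    (h : l ∈ solutionLists g L N) : ∃ x t, 0 < x ∧ l = x :: t := by
  obtain ⟨h1, h2, -⟩ := h
  cases l with
  | nil => simp at h1
  | cons x t => exact ⟨x, t, h2 x (by simp), rfl⟩

theorem modifyHead_image_solutionLists (g : Matrix (Fin 2) (Fin 2) ℤ) (L N : ℕ) :
    (List.modifyHead (· + 1)) '' solutionLists (g * !![1, 1; 0, 1]) L N =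
      {l ∈ solutionLists g (L + 1) N | ∀ t, l ≠ 1 :: t} := by
  ext l
  constructor
  · rintro ⟨l, hl, rfl⟩
    obtain ⟨x, t, hx, rfl⟩ := exists_cons_of_mem_solutionLists hl
    refine ⟨(cons_succ_mem_solutionLists g L N x hx t).2 hl, fun t' h => ?_⟩
    simp at h
    omega
  · rintro ⟨hl, hne⟩
    obtain ⟨x, t, hx, rfl⟩ := exists_cons_of_mem_solutionLists hl
    have hx1 : x ≠ 1 := fun h => hne t (by rw [h])
    refine ⟨(x - 1) :: t, ?_, by simp⟩
    rw [← cons_succ_mem_solutionLists g L N (x - 1) (by omega)]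
    simpa using hl

theorem encard_solutionLists (L N : ℕ) (g : Matrix (Fin 2) (Fin 2) ℤ) :
    (solutionLists g L N).encard = gapCount L N (g * M 1) := by
  induction L generalizing N g with
  | zero =>
    rw [solutionLists_zero, gapCount]
    split_ifs <;> simp
  | succ L ih =>
    have hinj : Function.Injective (List.modifyHead (· + (1 : ℤ))) := by
      rintro (_ | ⟨x, t⟩) (_ | ⟨y, u⟩) h <;> simp_all
    have hE : ({l ∈ solutionLists g (L + 1) N | ∀ t, l ≠ 1 :: t}).encard =
        gapCount L N (g * M 1 * !![1, 0; -1, 1]) := by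
      rw [← modifyHead_image_solutionLists, hinj.encard_image, ih, Matrix.mul_assoc,
        shift_mul_M_one, Matrix.mul_assoc]
    cases N with
    | zero =>
      rw [gapCount, ← hE]
      congr 1
      ext l
      refine ⟨fun h => ⟨h, fun t ht => ?_⟩, fun h => h.1⟩
      exact one_cons_notMem_solutionLists g L t (ht ▸ h)
    | succ N =>
      rw [gapCount, Nat.cast_add, ← hE, ← ih,
        ← (List.cons_injective (a := (1 : ℤ))).encard_image (solutionLists (g * M 1) L N),
        ← Set.encard_union_eq]
      · congr 1
        ext l
        constructor
        · intro h
          by_cases hl : ∃ t, l = 1 :: t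
          · obtain ⟨t, rfl⟩ := hl
            exact Or.inl ⟨t, (one_cons_mem_solutionLists g L N t).1 h, rfl⟩
          · exact Or.inr ⟨h, fun t ht => hl ⟨t, ht⟩⟩
        · rintro (⟨t, ht, rfl⟩ | h)
          · exact (one_cons_mem_solutionLists g L N t).2 ht
          · exact h.1
      · rw [Set.disjoint_left]
        rintro _ ⟨t, -, rfl⟩ h
        exact h.2 t rfl

/-- Products `U ^ ε₀ * S⁻¹ * ⋯ * U ^ εᵣ₋₁ * S⁻¹` with `U = M 1`, `S = M 0`, where `εᵢ ∈ {1, 2}`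
except that `ε₀` may be `0`; the second argument is the sum of the `2 - εᵢ`, the third is `r`. -/
inductive ReducedPrefix : Matrix (Fin 2) (Fin 2) ℤ → ℕ → ℕ → Prop
  | nil : ReducedPrefix 1 0 0
  | zero : ReducedPrefix !![0, 1; -1, 0] 2 1
  | one {h b r} : ReducedPrefix h b r → ReducedPrefix (h * !![1, 1; 0, 1]) (b + 1) (r + 1)
  | two {h b r} : ReducedPrefix h b r → ReducedPrefix (h * !![1, 0; 1, 1]) b (r + 1)

theorem ReducedPrefix.sign_pattern {h : Matrix (Fin 2) (Fin 2) ℤ} {b r : ℕ}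
    (H : ReducedPrefix h b r) :
    (h = 1 ∧ b = 0 ∧ r = 0) ∨
    (0 ≤ h 0 0 ∧ 0 ≤ h 0 1 ∧ 0 ≤ h 1 0 ∧ 0 ≤ h 1 1 ∧ 3 ≤ h 0 0 + h 0 1 + h 1 0 + h 1 1) ∨
    (0 ≤ h 0 0 ∧ 0 ≤ h 0 1 ∧ h 1 0 ≤ 0 ∧ h 1 1 ≤ 0) := by
  induction H with
  | nil => simp
  | zero => simp
  | one _ ih =>
    rcases ih with ⟨rfl, -, -⟩ | h | h
    · simp
    · right; left
      simp [Matrix.mul_apply, Fin.sum_univ_two]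
      omega
    · right; right
      simp [Matrix.mul_apply, Fin.sum_univ_two]
      omega
  | two _ ih =>
    rcases ih with ⟨rfl, -, -⟩ | h | h
    · simp
    · right; left
      simp [Matrix.mul_apply, Fin.sum_univ_two]
      omega
    · right; right
      simp [Matrix.mul_apply, Fin.sum_univ_two]
      omega

theorem isPMOne_iff (g : Matrix (Fin 2) (Fin 2) ℤ) :
    IsPMOne g ↔ (g 0 0 = 1 ∧ g 0 1 = 0 ∧ g 1 0 = 0 ∧ g 1 1 = 1) ∨
      (g 0 0 = -1 ∧ g 0 1 = 0 ∧ g 1 0 = 0 ∧ g 1 1 = -1) := by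
  simp [IsPMOne, ← Matrix.ext_iff, Fin.forall_fin_two, and_assoc]

theorem ReducedPrefix.eq_of_isPMOne {h : Matrix (Fin 2) (Fin 2) ℤ} {b r : ℕ}
    (H : ReducedPrefix h b r) (h1 : IsPMOne h) : b = 0 ∧ r = 0 := by
  rw [isPMOne_iff] at h1
  rcases H.sign_pattern with h2 | h2 | h2
  · exact h2.2
  · omega
  · omega

theorem ReducedPrefix.not_isPMOne_mul {h : Matrix (Fin 2) (Fin 2) ℤ} {b r : ℕ}
    (H : ReducedPrefix h b r) : ¬ IsPMOne (h * M 1) := by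
  rw [isPMOne_iff]
  simp only [M, Matrix.mul_apply, Fin.sum_univ_two]
  rcases H.sign_pattern with ⟨rfl, -⟩ | h2 | h2
  · simp
  · simp; omega
  · simp; omega

theorem ReducedPrefix.not_isPMOne_mul_mul {h : Matrix (Fin 2) (Fin 2) ℤ} {b r : ℕ}
    (H : ReducedPrefix h b r) : ¬ IsPMOne (h * M 1 * M 1) := by
  rw [isPMOne_iff]
  simp only [M, Matrix.mul_apply, Fin.sum_univ_two]
  rcases H.sign_pattern with ⟨rfl, -⟩ | h2 | h2
  · simp
  · simp; omega
  · simp; omega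

/-- Reduced elements `h * U ^ ε` of `PSL₂(ℤ)`, with `h` a reduced prefix and `ε ∈ {0, 1, 2}`; the
second argument is increased by `-ε` modulo `3`. -/
inductive Reduced : Matrix (Fin 2) (Fin 2) ℤ → ℕ → ℕ → Prop
  | zero {h b r} : ReducedPrefix h b r → Reduced h b r
  | one {h b r} : ReducedPrefix h b r → Reduced (h * M 1) (b + 2) r
  | two {h b r} : ReducedPrefix h b r → Reduced (h * M 1 * M 1) (b + 1) r

theorem Reduced.eq_of_isPMOne {g : Matrix (Fin 2) (Fin 2) ℤ} {a r : ℕ}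
    (H : Reduced g a r) (h1 : IsPMOne g) : a = 0 ∧ r = 0 := by
  cases H with
  | zero H => exact H.eq_of_isPMOne h1
  | one H => exact absurd h1 H.not_isPMOne_mul
  | two H => exact absurd h1 H.not_isPMOne_mul_mul

theorem Reduced.isPMOne {g : Matrix (Fin 2) (Fin 2) ℤ} (H : Reduced g 0 0) : IsPMOne g := by
  cases H with
  | zero H =>
    cases H
    exact Or.inl rfl

/-- Membership in `Reduced` up to sign. -/
def PMReduced (g : Matrix (Fin 2) (Fin 2) ℤ) (a r : ℕ) : Prop := Reduced g a r ∨ Reduced (-g) a r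

theorem pmReduced_neg (g : Matrix (Fin 2) (Fin 2) ℤ) (a r : ℕ) :
    PMReduced (-g) a r ↔ PMReduced g a r := by
  rw [PMReduced, PMReduced, neg_neg, or_comm]

/-- The effect on the parameters `(a, r)` of the two right multiplications in `gapCount`. -/
theorem PMReduced.step {g : Matrix (Fin 2) (Fin 2) ℤ} {a r : ℕ} (H : PMReduced g a r) :
    (∃ a', a = a' + 1 ∧ PMReduced (g * M 1) a' r ∧
      PMReduced (g * !![1, 0; -1, 1]) (a' + 2) (r + 1)) ∨
    (∃ r', r = r' + 1 ∧ PMReduced (g * M 1) (a + 2) r ∧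
      PMReduced (g * !![1, 0; -1, 1]) a r') ∨
    (a = 0 ∧ r = 0 ∧ PMReduced (g * M 1) 2 0 ∧ PMReduced (g * !![1, 0; -1, 1]) 4 1) := by
  wlog hg : Reduced g a r generalizing g
  · simpa only [Matrix.neg_mul, pmReduced_neg] using
      this (g := -g) ((pmReduced_neg g a r).2 H) (H.resolve_left hg)
  have e1 : M 1 * !![1, 0; -1, 1] = !![1, 1; 0, 1] * M 1 := by simp [M]
  have e2 : M 1 * M 1 * !![1, 0; -1, 1] = !![1, 0; 1, 1] * M 1 := by simp [M]
  have e3 : M 1 * M 1 * M 1 = -1 := by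
    ext i j; fin_cases i <;> fin_cases j <;> simp [M]
  have e4 : !![1, 0; -1, 1] = !![0, 1; -1, 0] * M 1 := by simp [M]
  have e5 : !![0, 1; -1, 0] * !![1, 0; -1, 1] = -M 1 := by
    ext i j; fin_cases i <;> fin_cases j <;> simp [M]
  have e6 : !![1, 1; 0, 1] * !![1, 0; -1, 1] = -(M 1 * M 1) := by
    ext i j; fin_cases i <;> fin_cases j <;> simp [M]
  have e7 : !![1, 0; 1, 1] * !![1, 0; -1, 1] = (1 : Matrix (Fin 2) (Fin 2) ℤ) := by
    ext i j; fin_cases i <;> fin_cases j <;> simp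
  clear H
  cases hg with
  | @one h b r H =>
    refine Or.inl ⟨b + 1, rfl, Or.inl (.two H), Or.inl ?_⟩
    rw [Matrix.mul_assoc, e1, ← Matrix.mul_assoc]
    exact .one (.one H)
  | @two h b r H =>
    refine Or.inl ⟨b, rfl, Or.inr ?_, Or.inl ?_⟩
    · rw [Matrix.mul_assoc, Matrix.mul_assoc, ← Matrix.mul_assoc (M 1), e3]
      simpa using .zero H
    · rw [Matrix.mul_assoc, Matrix.mul_assoc, ← Matrix.mul_assoc (M 1), e2, ← Matrix.mul_assoc]
      exact .one (.two H)
  | zero H =>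
    have HU := Reduced.one H
    cases H with
    | nil =>
      refine Or.inr (Or.inr ⟨rfl, rfl, Or.inl HU, Or.inl ?_⟩)
      rw [Matrix.one_mul, e4]
      exact .one .zero
    | zero =>
      refine Or.inr (Or.inl ⟨0, rfl, Or.inl HU, Or.inr ?_⟩)
      rw [e5, neg_neg, ← Matrix.one_mul (M 1)]
      exact .one .nil
    | @one h b r H =>
      refine Or.inr (Or.inl ⟨r, rfl, Or.inl HU, Or.inr ?_⟩)
      rw [Matrix.mul_assoc, e6, Matrix.mul_neg, neg_neg, ← Matrix.mul_assoc]
      exact .two H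
    | @two h b r H =>
      refine Or.inr (Or.inl ⟨r, rfl, Or.inl HU, Or.inl ?_⟩)
      rw [Matrix.mul_assoc, e7, Matrix.mul_one]
      exact .zero H

theorem PMReduced.isPMOne_iff {g : Matrix (Fin 2) (Fin 2) ℤ} {a r : ℕ} (H : PMReduced g a r) :
    IsPMOne g ↔ a = 0 ∧ r = 0 := by
  constructor
  · intro h
    rcases H with H | H
    · exact H.eq_of_isPMOne h
    · exact H.eq_of_isPMOne ((isPMOne_neg g).2 h)
  · rintro ⟨rfl, rfl⟩
    rcases H with H | H
    · exact H.isPMOne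
    · exact (isPMOne_neg g).1 H.isPMOne

/-- If `y = t + y² / (1 - c y²)`, the coefficient of `t ^ (m + p + 2 s) * c ^ s` in the power series
`y ^ m / (1 - c y²) ^ r`. -/
def lagrangeCoeff (m r p s : ℕ) : ℚ :=
  if m + p + 2 * s = 0 then 1 else
    (m + p + 2 * s).multichoose p / ((m + p + 2 * s : ℕ) : ℚ) *
      (m * (p + r).multichoose s + 2 * r *
        if s = 0 then 0 else ((p + r + 1).multichoose (s - 1) : ℚ))

theorem lagrangeCoeff_of_ne_zero {m p s : ℕ} (r : ℕ) (h : m + p + 2 * s ≠ 0) :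
    lagrangeCoeff m r p s = (m + p + 2 * s).multichoose p / ((m + p + 2 * s : ℕ) : ℚ) *
      (m * (p + r).multichoose s + 2 * r *
        if s = 0 then 0 else ((p + r + 1).multichoose (s - 1) : ℚ)) :=
  if_neg h

theorem multichoose_succ_mul (w s : ℕ) :
    (s + 1) * w.multichoose (s + 1) = w * (w + 1).multichoose s := by
  rcases w with _ | w
  · simp
  · rw [Nat.multichoose_eq, Nat.multichoose_eq]
    have h := Nat.choose_succ_right_eq (w + 1 + s) s
    simp only [show w + 1 + (s + 1) - 1 = w + 1 + s by omega,
      show w + 1 + 1 + s - 1 = w + 1 + s by omega]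
    rw [show w + 1 + s - s = w + 1 by omega] at h
    linarith

theorem mul_multichoose_eq_ite (w s : ℕ) :
    (w * if s = 0 then 0 else ((w + 1).multichoose (s - 1) : ℚ)) = s * w.multichoose s := by
  cases s with
  | zero => simp
  | succ s => simpa using (mod_cast (multichoose_succ_mul w s).symm :
      (w : ℚ) * (w + 1).multichoose s = (s + 1) * w.multichoose (s + 1))

theorem lagrangeCoeff_zero_right (m r s : ℕ) : lagrangeCoeff m r 0 s = r.multichoose s := by
  by_cases h : m + 0 + 2 * s = 0
  · obtain ⟨rfl, rfl⟩ : m = 0 ∧ s = 0 := by omega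
    simp [lagrangeCoeff]
  · have h1 := mul_multichoose_eq_ite r s
    have h2 : ((m + 0 + 2 * s : ℕ) : ℚ) ≠ 0 := by exact_mod_cast h
    rw [lagrangeCoeff_of_ne_zero r h, zero_add, mul_assoc, h1, Nat.multichoose_zero_right]
    field_simp
    push_cast
    ring

theorem lagrangeCoeff_succ_zero (m r s : ℕ) :
    lagrangeCoeff (m + 1) r 0 s = lagrangeCoeff m r 0 s := by
  rw [lagrangeCoeff_zero_right, lagrangeCoeff_zero_right]

theorem lagrangeCoeff_succ_succ (m r p s : ℕ) :
    lagrangeCoeff (m + 1) r (p + 1) s =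
      lagrangeCoeff m r (p + 1) s + lagrangeCoeff (m + 2) (r + 1) p s := by
  rw [lagrangeCoeff_of_ne_zero _ (by omega), lagrangeCoeff_of_ne_zero _ (by omega),
    lagrangeCoeff_of_ne_zero _ (by omega)]
  have h1 := mul_multichoose_eq_ite (p + 1 + r) s
  simp only [show p + (r + 1) = p + 1 + r by omega]
  generalize (if s = 0 then 0 else ((p + 1 + r + 1).multichoose (s - 1) : ℚ)) = B at *
  generalize ((p + 1 + r).multichoose s : ℚ) = A at *
  set Q := m + (p + 1) + 2 * s with hQ
  rw [show m + 1 + (p + 1) + 2 * s = Q + 1 by omega, show m + 2 + p + 2 * s = Q + 1 by omega,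
    Nat.multichoose_succ_succ]
  have h2 : ((p : ℚ) + 1) * Q.multichoose (p + 1) = Q * (Q + 1).multichoose p := by
    exact_mod_cast multichoose_succ_mul Q p
  have h3 : (Q : ℚ) = m + (p + 1) + 2 * s := by rw [hQ]; push_cast; ring
  have h4 : (Q : ℚ) ≠ 0 := by rw [h3]; positivity
  have h5 : (Q : ℚ) + 1 ≠ 0 := by positivity
  have h6 : ((Q + 1).multichoose p : ℚ) = (p + 1) * Q.multichoose (p + 1) / Q := by
    rw [h2]; field_simp
  push_cast at h1 ⊢
  rw [h6]
  generalize (Q.multichoose (p + 1) : ℚ) = X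
  field_simp
  rw [h3]
  linear_combination (-2 * X) * h1

theorem lagrangeCoeff_exponent_zero (m r p : ℕ) :
    lagrangeCoeff m (r + 1) p 0 = lagrangeCoeff m r p 0 := by
  simp [lagrangeCoeff]

theorem lagrangeCoeff_exponent_succ (m r p s : ℕ) :
    lagrangeCoeff m (r + 1) p (s + 1) =
      lagrangeCoeff (m + 2) (r + 1) p s + lagrangeCoeff m r p (s + 1) := by
  rw [lagrangeCoeff_of_ne_zero _ (by omega), lagrangeCoeff_of_ne_zero _ (by omega),
    lagrangeCoeff_of_ne_zero _ (by omega),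
    show m + 2 + p + 2 * s = m + p + 2 * (s + 1) by omega, ← add_assoc p r 1]
  simp only [Nat.multichoose_succ_succ, Nat.add_one_ne_zero, if_false, Nat.add_sub_cancel]
  cases s with
  | zero => simp; ring
  | succ s =>
    simp only [Nat.multichoose_succ_succ, Nat.add_one_ne_zero, if_false, Nat.add_sub_cancel]
    push_cast
    ring

theorem lagrangeCoeff_zero_zero (p s : ℕ) (h : p + s ≠ 0) : lagrangeCoeff 0 0 p s = 0 := by
  rw [lagrangeCoeff_of_ne_zero _ (by omega)]
  simp

/-- The number `gapCount (3 p + a + 3 k + r) (p + a + 3 k) g` at a reduced `g` with parameters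
`(a, r)`. -/
def reducedCount (a r p k : ℕ) : ℚ :=
  ∑ s ∈ Finset.range (k + 1), lagrangeCoeff (a + 3 * (k - s)) r p s

theorem reducedCount_zero_right (a r p : ℕ) :
    reducedCount a r p 0 = lagrangeCoeff a r p 0 := by
  simp [reducedCount]

theorem reducedCount_succ_zero (a r k : ℕ) :
    reducedCount (a + 1) r 0 k = reducedCount a r 0 k := by
  unfold reducedCount
  refine Finset.sum_congr rfl fun s _ => ?_
  rw [add_right_comm, lagrangeCoeff_succ_zero]

theorem reducedCount_succ_succ (a r p k : ℕ) :
    reducedCount (a + 1) r (p + 1) k =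
      reducedCount a r (p + 1) k + reducedCount (a + 2) (r + 1) p k := by
  unfold reducedCount
  rw [← Finset.sum_add_distrib]
  refine Finset.sum_congr rfl fun s _ => ?_
  rw [add_right_comm, lagrangeCoeff_succ_succ, add_right_comm a]

theorem reducedCount_exponent_zero (a r p : ℕ) :
    reducedCount a (r + 1) p 0 = reducedCount a r p 0 := by
  simp only [reducedCount_zero_right, lagrangeCoeff_exponent_zero]

theorem reducedCount_exponent_succ (a r p k : ℕ) :
    reducedCount a (r + 1) p (k + 1) =
      reducedCount (a + 2) (r + 1) p k + reducedCount a r p (k + 1) := by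
  unfold reducedCount
  rw [Finset.sum_range_succ', Finset.sum_range_succ' _ (k + 1), ← add_assoc,
    ← Finset.sum_add_distrib, lagrangeCoeff_exponent_zero]
  congr 1
  refine Finset.sum_congr rfl fun s _ => ?_
  rw [lagrangeCoeff_exponent_succ, Nat.add_sub_add_right, add_right_comm]

theorem reducedCount_zero_zero_succ (p k : ℕ) :
    reducedCount 0 0 p (k + 1) = reducedCount 3 0 p k := by
  unfold reducedCount
  rw [Finset.sum_range_succ, Nat.sub_self, Nat.mul_zero, Nat.add_zero,
    lagrangeCoeff_zero_zero p (k + 1) (by omega), add_zero]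
  refine Finset.sum_congr rfl fun s hs => ?_
  rw [Finset.mem_range] at hs
  congr 1
  omega

theorem exists_of_gapCount_ne_zero (L N : ℕ) (g : Matrix (Fin 2) (Fin 2) ℤ) (a r : ℕ)
    (H : PMReduced g a r) (h : gapCount L N g ≠ 0) :
    ∃ p k, L = 3 * p + a + 3 * k + r ∧ N = p + a + 3 * k := by
  induction L generalizing N g a r with
  | zero =>
    simp only [gapCount, H.isPMOne_iff, ne_eq, ite_eq_right_iff, one_ne_zero, imp_false,
      not_not] at h
    exact ⟨0, 0, by omega, by omega⟩
  | succ L ih =>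
    have hor : (∃ N', N = N' + 1 ∧ gapCount L N' (g * M 1) ≠ 0) ∨
        gapCount L N (g * !![1, 0; -1, 1]) ≠ 0 := by
      cases N with
      | zero => exact Or.inr h
      | succ N =>
        by_contra! hc
        exact h (by rw [gapCount, hc.1 N rfl, hc.2])
    rcases H.step with ⟨a', rfl, H1, H2⟩ | ⟨r', rfl, H1, H2⟩ | ⟨rfl, rfl, H1, H2⟩ <;>
    rcases hor with ⟨N', rfl, h1⟩ | h2
    · obtain ⟨p, k, hp, hk⟩ := ih _ _ _ _ H1 h1
      exact ⟨p, k, by omega, by omega⟩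
    · obtain ⟨p, k, hp, hk⟩ := ih _ _ _ _ H2 h2
      exact ⟨p + 1, k, by omega, by omega⟩
    · obtain ⟨p, k, hp, hk⟩ := ih _ _ _ _ H1 h1
      exact ⟨p, k + 1, by omega, by omega⟩
    · obtain ⟨p, k, hp, hk⟩ := ih _ _ _ _ H2 h2
      exact ⟨p, k, by omega, by omega⟩
    · obtain ⟨p, k, hp, hk⟩ := ih _ _ _ _ H1 h1
      exact ⟨p, k + 1, by omega, by omega⟩
    · obtain ⟨p, k, hp, hk⟩ := ih _ _ _ _ H2 h2
      exact ⟨p + 1, k + 1, by omega, by omega⟩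

theorem gapCount_eq_zero {L N : ℕ} {g : Matrix (Fin 2) (Fin 2) ℤ} {a r : ℕ}
    (H : PMReduced g a r) (h : ∀ p k, L = 3 * p + a + 3 * k + r → N ≠ p + a + 3 * k) :
    gapCount L N g = 0 := by
  by_contra hc
  obtain ⟨p, k, h1, h2⟩ := exists_of_gapCount_ne_zero L N g a r H hc
  exact h p k h1 h2

theorem gapCount_eq_reducedCount (L N : ℕ) (g : Matrix (Fin 2) (Fin 2) ℤ) (a r p k : ℕ)
    (H : PMReduced g a r) (hL : L = 3 * p + a + 3 * k + r) (hN : N = p + a + 3 * k) :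
    (gapCount L N g : ℚ) = reducedCount a r p k := by
  induction L generalizing N g a r p k with
  | zero =>
    obtain ⟨rfl, rfl, rfl, rfl⟩ : a = 0 ∧ r = 0 ∧ p = 0 ∧ k = 0 := by omega
    simp [gapCount, H.isPMOne_iff, hN, reducedCount, lagrangeCoeff]
  | succ L ih =>
    rcases H.step with ⟨a, rfl, H1, H2⟩ | ⟨r, rfl, H1, H2⟩ | ⟨rfl, rfl, H1, H2⟩
    · obtain ⟨N, rfl⟩ : ∃ N', N = N' + 1 := ⟨N - 1, by omega⟩
      rw [gapCount, Nat.cast_add, ih N _ a r p k H1 (by omega) (by omega)]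
      cases p with
      | zero =>
        rw [gapCount_eq_zero H2 fun p' k' => by omega, reducedCount_succ_zero, Nat.cast_zero,
          add_zero]
      | succ p =>
        rw [ih _ _ _ _ p k H2 (by omega) (by omega), reducedCount_succ_succ]
    · cases k with
      | zero =>
        have h2 := ih N _ a r p 0 H2 (by omega) (by omega)
        rw [reducedCount_exponent_zero, ← h2]
        cases N with
        | zero => rfl
        | succ N =>
          rw [gapCount, gapCount_eq_zero H1 fun p' k' => by omega, zero_add]
      | succ k =>
        obtain ⟨N, rfl⟩ : ∃ N', N = N' + 1 := ⟨N - 1, by omega⟩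
        rw [gapCount, Nat.cast_add, ih N _ _ _ p k H1 (by omega) (by omega),
          ih _ _ _ _ p (k + 1) H2 (by omega) (by omega), reducedCount_exponent_succ]
    · cases k with
      | zero =>
        rw [reducedCount_zero_right, lagrangeCoeff_zero_zero p 0 (by omega)]
        have h2 : gapCount L N (g * !![1, 0; -1, 1]) = 0 :=
          gapCount_eq_zero H2 fun p' k' => by omega
        cases N with
        | zero => rw [gapCount, h2, Nat.cast_zero]
        | succ N => rw [gapCount, gapCount_eq_zero H1 fun p' k' => by omega, h2, Nat.cast_zero]
      | succ k =>
        obtain ⟨N, rfl⟩ : ∃ N', N = N' + 1 := ⟨N - 1, by omega⟩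
        rw [gapCount, Nat.cast_add, ih N _ _ _ p k H1 (by omega) (by omega),
          reducedCount_zero_zero_succ]
        cases p with
        | zero =>
          rw [gapCount_eq_zero H2 fun p' k' => by omega, reducedCount_succ_zero 2, Nat.cast_zero,
            add_zero]
        | succ p =>
          rw [ih _ _ _ _ p k H2 (by omega) (by omega), reducedCount_succ_succ 2]

theorem pmReduced_M_one : PMReduced (M 1) 2 0 := by
  have h := Reduced.one .nil
  rw [Matrix.one_mul] at h
  exact Or.inl h

theorem ncard_solutionLists (p k : ℕ) :
    ((solutionLists 1 (3 * p + 2 + 3 * k) (p + 2 + 3 * k)).ncard : ℚ) = reducedCount 2 0 p k := by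
  rw [Set.ncard, encard_solutionLists, Matrix.one_mul, ENat.toNat_natCast]
  exact gapCount_eq_reducedCount _ _ _ _ _ _ _ pmReduced_M_one rfl rfl

theorem reducedCount_two_zero (p k : ℕ) :
    reducedCount 2 0 p k = ∑ s ∈ Finset.range (k + 1),
      ((3 * ((k : ℚ) - s) + 2) / (((p + 3 * k + 1 : ℕ) : ℚ) - s + 1)) *
        Cq (((p + 3 * k + 1 : ℕ) : ℤ) - 3 * k + s - 2) s *
        Cq (2 * ((p + 3 * k + 1 : ℕ) : ℤ) - 3 * k - s - 1) (p + 3 * k + 1 - 3 * k - 1) := by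
  unfold reducedCount
  refine Finset.sum_congr rfl fun s hs => ?_
  rw [Finset.mem_range] at hs
  obtain ⟨j, rfl⟩ : ∃ j, k = s + j := ⟨k - s, by omega⟩
  have h1 : Cq (((p + 3 * (s + j) + 1 : ℕ) : ℤ) - 3 * (s + j : ℕ) + s - 2) s =
      p.multichoose s := by
    unfold Cq
    split_ifs with h h'
    · rw [Nat.multichoose_eq]
      congr 2
      omega
    · simp [h']
    · omega
  have h2 : Cq (2 * ((p + 3 * (s + j) + 1 : ℕ) : ℤ) - 3 * (s + j : ℕ) - s - 1)
      (p + 3 * (s + j) + 1 - 3 * (s + j) - 1) = (2 + 3 * j + p + 2 * s).multichoose p := by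
    unfold Cq
    rw [if_pos (by omega), Nat.multichoose_eq]
    congr 2 <;> omega
  rw [h1, h2, Nat.add_sub_cancel_left, lagrangeCoeff_of_ne_zero _ (by omega)]
  push_cast
  rw [show (p : ℚ) + 3 * (s + j) + 1 - s + 1 = 2 + 3 * j + p + 2 * s by ring]
  simp only [add_zero, mul_zero, zero_mul]
  ring

theorem solutionLists_eq_empty {L n : ℕ} (h : ∀ k, 3 * k < n → L + 6 * k + 1 ≠ 3 * n) :
    solutionLists 1 L (n + 1) = ∅ := by
  rw [← Set.encard_eq_zero, encard_solutionLists, Matrix.one_mul,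
    gapCount_eq_zero pmReduced_M_one, Nat.cast_zero]
  intro p k h1 h2
  exact h k (by omega) (by omega)

theorem iUnion_solutionLists (n : ℕ) :
    {l : List ℤ | l.length = n + 2 ∧ (∀ a ∈ l, 0 < a) ∧ IsPMOne (l.map M).prod} =
      ⋃ k ∈ (Finset.range n).filter (fun k => 3 * k < n),
        solutionLists 1 (3 * n - 6 * k - 1) (n + 1) := by
  ext l
  simp only [Set.mem_iUnion, Finset.mem_filter, Finset.mem_range]
  constructor
  · rintro ⟨h1, h2, h3⟩
    have h4 := length_le_sum_of_pos l h2
    have hl : l ∈ solutionLists 1 (l.sum.toNat - 1) (n + 1) :=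
      ⟨h1, h2, by omega, by simpa using h3⟩
    by_contra! hc
    rw [solutionLists_eq_empty] at hl
    · exact hl
    · intro k hk h
      refine hc k ⟨by omega, hk⟩ ?_
      rwa [show 3 * n - 6 * k - 1 = l.sum.toNat - 1 by omega]
  · rintro ⟨k, -, h1, h2, -, h3⟩
    exact ⟨h1, h2, by simpa using h3⟩

theorem pairwiseDisjoint_solutionLists (n : ℕ) :
    (((Finset.range n).filter (fun k => 3 * k < n) : Finset ℕ) : Set ℕ).PairwiseDisjoint
      fun k => solutionLists 1 (3 * n - 6 * k - 1) (n + 1) := by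
  intro i hi j hj hij
  simp only [Finset.coe_filter, Finset.mem_range, Set.mem_ofPred_eq] at hi hj
  rw [Function.onFun, Set.disjoint_left]
  rintro l ⟨-, -, h1, -⟩ ⟨-, -, h2, -⟩
  omega

theorem solutionLists_finite (g : Matrix (Fin 2) (Fin 2) ℤ) (L N : ℕ) :
    (solutionLists g L N).Finite := by
  rw [← Set.encard_ne_top_iff, encard_solutionLists]
  exact ENat.natCast_ne_top _

theorem image_ofFn_eq (n : ℕ) :
    List.ofFn '' {a : Fin (n + 2) → ℤ | (∀ i, 0 < a i) ∧
        ((List.ofFn fun i => M (a i)).prod = 1 ∨ (List.ofFn fun i => M (a i)).prod = -1)} =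
      {l : List ℤ | l.length = n + 2 ∧ (∀ a ∈ l, 0 < a) ∧ IsPMOne (l.map M).prod} := by
  have hmap (a : Fin (n + 2) → ℤ) : (List.ofFn a).map M = List.ofFn fun i => M (a i) :=
    List.map_ofFn
  ext l
  constructor
  · rintro ⟨a, ⟨h1, h2⟩, rfl⟩
    refine ⟨by simp, List.forall_mem_ofFn_iff.2 h1, ?_⟩
    rw [hmap]
    exact h2
  · rintro ⟨h1, h2, h3⟩
    have hl : List.ofFn (fun i : Fin (n + 2) => l.get (i.cast h1.symm)) = l := by
      refine List.ext_getElem (by simp [h1]) fun i _ _ => ?_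
      rw [List.getElem_ofFn]
      rfl
    refine ⟨_, ⟨fun i => h2 _ (List.get_mem _ _), ?_⟩, hl⟩
    rw [← hl, hmap] at h3
    exact h3

theorem stmt1 (n : ℕ) (hn : 1 ≤ n) :
    (Set.ncard {a : Fin (n + 2) → ℤ | (∀ i, 0 < a i) ∧
        ((List.ofFn fun i => M (a i)).prod = 1 ∨
          (List.ofFn fun i => M (a i)).prod = -1)} : ℚ) =
    ∑ k ∈ (Finset.range n).filter (fun k => 3 * k < n), ∑ s ∈ Finset.range (k + 1),
      ((3 * ((k : ℚ) - s) + 2) / ((n : ℚ) - s + 1)) *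
        Cq ((n : ℤ) - 3 * k + s - 2) s *
        Cq (2 * (n : ℤ) - 3 * k - s - 1) (n - 3 * k - 1) := by
  rw [← Set.ncard_image_of_injective _ List.ofFn_injective, image_ofFn_eq, iUnion_solutionLists,
    ← Finset.set_biUnion_coe, (Finset.finite_toSet _).ncard_biUnion
      (fun _ _ => solutionLists_finite _ _ _) (pairwiseDisjoint_solutionLists n),
    finsum_mem_coe_finset, Nat.cast_sum]
  refine Finset.sum_congr rfl fun k hk => ?_
  obtain ⟨-, hk⟩ := Finset.mem_filter.1 hk
  obtain ⟨p, rfl⟩ : ∃ p, n = p + 3 * k + 1 := ⟨n - 3 * k - 1, by omega⟩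
  rw [← reducedCount_two_zero, ← ncard_solutionLists]
  congr 3 <;> omega
end

section
/- Let n ≥ 1 and let k be a non-negative integer with 3k < n. The number of tuples (a_1, …, a_{n+2}) of positive integers satisfying M(a_1)·M(a_2)···M(a_{n+2}) = Id or −Id and a_1 + ⋯ + a_{n+2} = 3(n − 2k) equals Σ_{s=0}^{k} ((3(k−s)+2)/(n−s+1)) · C(n−3k+s−2, s) · C(2n−3k−s−1, n−3k−1). -/
namespace Quiddity

section Lagrange

open PowerSeries

variable {R : Type*} [CommRing R] [Algebra ℚ R]

/-- The coefficient of `t ^ N` in `H(w)`, where `w` is the power series in `t` determined by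
`w = t * ψ(w)`, as given by Lagrange's formula. -/
noncomputable def lagrange (ψ : R⟦X⟧) : ℕ → R⟦X⟧ → R
  | 0, H => coeff 0 H
  | N + 1, H => ((N + 1 : ℚ)⁻¹) • coeff N (d⁄dX R H * ψ ^ (N + 1))

theorem lagrange_add (ψ H K : R⟦X⟧) (N : ℕ) :
    lagrange ψ N (H + K) = lagrange ψ N H + lagrange ψ N K := by
  cases N <;> simp [lagrange, add_mul]

theorem lagrange_C_mul (ψ H : R⟦X⟧) (c : R) (N : ℕ) :
    lagrange ψ N (C c * H) = c * lagrange ψ N H := by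
  cases N with
  | zero => simp [lagrange]
  | succ N =>
    have h : d⁄dX R (C c * H) = C c * d⁄dX R H := by
      simp [Derivation.leibniz]
    rw [lagrange, lagrange, h, mul_assoc, coeff_C_mul, mul_smul_comm]

theorem lagrange_sum {ι : Type*} (ψ : R⟦X⟧) (s : Finset ι) (H : ι → R⟦X⟧) (N : ℕ) :
    lagrange ψ N (∑ i ∈ s, H i) = ∑ i ∈ s, lagrange ψ N (H i) := by
  cases N <;> simp [lagrange, Finset.sum_mul, Finset.smul_sum]

theorem lagrange_zero_X_mul (ψ H : R⟦X⟧) : lagrange ψ 0 (X * H) = 0 := by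
  simp [lagrange]

theorem lagrange_one (ψ : R⟦X⟧) (N : ℕ) : lagrange ψ N 1 = if N = 0 then 1 else 0 := by
  cases N <;> simp [lagrange]

theorem lagrange_succ_X_mul (ψ H : R⟦X⟧) (N : ℕ) :
    lagrange ψ (N + 1) (X * H) = lagrange ψ N (ψ * H) := by
  have hX : d⁄dX R (X * H) = H + X * d⁄dX R H := by
    simp [Derivation.leibniz, add_comm]
  cases N with
  | zero => simp [lagrange, mul_comm]
  | succ N =>
    have hpow : d⁄dX R (H * ψ ^ (N + 2)) =
        d⁄dX R H * ψ ^ (N + 2) + C ((N : R) + 2) * (H * ψ ^ (N + 1) * d⁄dX R ψ) := by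
      have h2 : (C (2 : R) : R⟦X⟧) = 2 := map_ofNat C 2
      simp [Derivation.leibniz, Derivation.leibniz_pow, h2]
      ring
    have hψ : d⁄dX R (ψ * H) * ψ ^ (N + 1) =
        d⁄dX R H * ψ ^ (N + 2) + H * ψ ^ (N + 1) * d⁄dX R ψ := by
      simp [Derivation.leibniz]
      ring
    have hcoeff := coeff_derivative (H * ψ ^ (N + 2)) N
    rw [hpow, map_add, coeff_C_mul] at hcoeff
    have hsplit : (H + X * d⁄dX R H) * ψ ^ (N + 2) =
        H * ψ ^ (N + 2) + X * (d⁄dX R H * ψ ^ (N + 2)) := by ring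
    simp only [lagrange]
    rw [hX, hψ, hsplit, map_add, map_add, coeff_succ_X_mul]
    set a := coeff (N + 1) (H * ψ ^ (N + 2))
    set b := coeff N (d⁄dX R H * ψ ^ (N + 2))
    set c := coeff N (H * ψ ^ (N + 1) * d⁄dX R ψ)
    have h1 : (((N + 1 : ℕ) : ℚ) + 1) ≠ 0 := by positivity
    have h2 : ((N : ℚ) + 1) ≠ 0 := by positivity
    rw [inv_smul_eq_iff₀ h1, smul_comm, eq_inv_smul_iff₀ h2]
    simp only [Algebra.smul_def, map_add, map_natCast, map_one]
    push_cast
    linear_combination -hcoeff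

/-- The sequence `f` spread over the indices `b, b + 2, b + 4, …`. -/
def spread {α : Type*} [Zero α] (f : ℕ → α) (b q : ℕ) : α :=
  if b ≤ q ∧ Even (q - b) then f ((q - b) / 2) else 0

theorem spread_zero_two_mul {α : Type*} [Zero α] (f : ℕ → α) (N : ℕ) :
    spread f 0 (2 * N) = f N := by
  simp [spread]

theorem spread_succ_zero {α : Type*} [Zero α] (f : ℕ → α) (b : ℕ) : spread f (b + 1) 0 = 0 := by
  simp [spread]

theorem spread_succ_succ {α : Type*} [Zero α] (f : ℕ → α) (b q : ℕ) :
    spread f (b + 1) (q + 1) = spread f b q := by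
  simp [spread]

theorem spread_add {α : Type*} [AddMonoid α] (f g : ℕ → α) (b q : ℕ) :
    spread (fun N => f N + g N) b q = spread f b q + spread g b q := by
  unfold spread; split_ifs <;> simp

theorem spread_mul {α : Type*} [MulZeroClass α] (x : α) (f : ℕ → α) (b q : ℕ) :
    spread (fun N => x * f N) b q = x * spread f b q := by
  unfold spread; split_ifs <;> simp

theorem spread_single {α : Type*} [Zero α] [One α] (b q : ℕ) :
    spread (fun N => if N = 0 then (1 : α) else 0) b q = if q = b then 1 else 0 := by
  unfold spread
  split_ifs <;> grind

theorem spread_lagrange_X_mul_zero (ψ H : R⟦X⟧) (b : ℕ) :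
    spread (fun N => lagrange ψ N (X * H)) b 0 = 0 := by
  unfold spread
  split_ifs <;> simp [lagrange_zero_X_mul]

theorem spread_lagrange_X_mul_succ (ψ H : R⟦X⟧) (b q : ℕ) :
    spread (fun N => lagrange ψ N (X * H)) b (q + 1) =
      spread (fun N => lagrange ψ N (ψ * H)) (b + 1) q := by
  unfold spread
  by_cases h : b + 1 ≤ q ∧ Even (q - (b + 1))
  · have h' : b ≤ q + 1 ∧ Even (q + 1 - b) := by grind
    have h2 : (q + 1 - b) / 2 = (q - (b + 1)) / 2 + 1 := by omega
    simp only [if_pos h, if_pos h', h2, lagrange_succ_X_mul]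
  · rw [if_neg h]
    split_ifs with h'
    · have h2 : (q + 1 - b) / 2 = 0 := by grind
      simp only [h2, lagrange_zero_X_mul]
    · rfl

end Lagrange

section Automaton

/-- Reading the generator of order three. Together with `stepT`, this is the action of words on
vertices of the tree of triangles attached to `ℤ/2 * ℤ/3`; a state lists, from the current
triangle back to the root, the number of rotations missing to reach the last vertex. -/
def stepU : List ℕ → List ℕ
  | [] => []
  | 0 :: l => 2 :: l
  | (d + 1) :: l => d :: l

/-- Reading the product of the generators of orders three and two. -/
def stepT : List ℕ → List ℕ
  | [] => []
  | [0] => [2, 2]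
  | 0 :: e :: l => e :: l
  | (d + 1) :: l => 2 :: d :: l

end Automaton

section Weights

open PowerSeries

/-- The generating function of one rotation of a triangle. -/
noncomputable def rot : ℚ⟦X⟧⟦X⟧ := C X * (1 + X)

/-- The series whose Lagrange inversion gives the correction in `rot`. -/
noncomputable def kernel (P : ℚ⟦X⟧⟦X⟧) : ℚ⟦X⟧⟦X⟧ := C X * (1 + X) ^ 2 * P

/-- The generating function of the words leading from a state to the state `[0]`. -/
noncomputable def weight (P D : ℚ⟦X⟧⟦X⟧) (l : List ℕ) (q : ℕ) : ℚ⟦X⟧ :=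
  spread (fun N => lagrange (kernel P) N (rot ^ l.sum * P ^ (l.length - 1) * D)) (l.length - 1) q

theorem spread_lagrange_rot_mul_zero (P H : ℚ⟦X⟧⟦X⟧) (b : ℕ) :
    spread (fun N => lagrange (kernel P) N (rot * H)) b 0 =
      X * spread (fun N => lagrange (kernel P) N H) b 0 := by
  have h : rot * H = C X * H + X * (C X * H) := by rw [rot]; ring
  simp only [h, lagrange_add, spread_add, spread_lagrange_X_mul_zero, lagrange_C_mul, spread_mul,
    add_zero]

theorem spread_lagrange_rot_mul_succ (P H : ℚ⟦X⟧⟦X⟧) (b q : ℕ) :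
    spread (fun N => lagrange (kernel P) N (rot * H)) b (q + 1) =
      X * spread (fun N => lagrange (kernel P) N H) b (q + 1) +
        spread (fun N => lagrange (kernel P) N (rot ^ 2 * P * H)) (b + 1) q := by
  have h : rot * H = C X * H + X * (C X * H) := by rw [rot]; ring
  have h' : kernel P * (C X * H) = rot ^ 2 * P * H := by rw [rot, kernel]; ring
  simp only [h, lagrange_add, spread_add, spread_lagrange_X_mul_succ, h', lagrange_C_mul,
    spread_mul]

variable {P D : ℚ⟦X⟧⟦X⟧}

theorem weight_zero (hP : P * (1 - C X * rot ^ 2) = 1) (hD : D * (1 - rot ^ 3) = 1)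
    {l : List ℕ} (hl : l ≠ []) :
    weight P D l 0 = (if l = [0] then 1 else 0) + X * weight P D (stepU l) 0 := by
  match l with
  | [0] =>
    have h : rot ^ 0 * P ^ 0 * D = 1 + rot * (rot ^ 2 * P ^ 0 * D) := by
      linear_combination hD
    simp only [weight, stepU, List.sum_cons, List.sum_nil, List.length_cons, List.length_nil,
      add_zero, zero_add, if_true]
    simp only [h, lagrange_add, spread_add, spread_lagrange_rot_mul_zero, lagrange_one,
      spread_single, if_true]
  | 0 :: e :: l =>
    have h : rot ^ (0 + (e + l.sum)) * P ^ (l.length + 1) * D =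
        rot ^ (e + l.sum) * P ^ l.length * D +
          C X * (rot ^ (2 + (e + l.sum)) * P ^ (l.length + 1) * D) := by
      linear_combination (rot ^ (e + l.sum) * P ^ l.length * D) * hP
    simp only [weight, stepU, List.sum_cons, List.length_cons, Nat.add_sub_cancel]
    simp only [h, lagrange_add, spread_add, lagrange_C_mul, spread_mul]
    simp [spread_succ_zero]
  | (d + 1) :: l =>
    have h : rot ^ (d + 1 + l.sum) * P ^ l.length * D =
        rot * (rot ^ (d + l.sum) * P ^ l.length * D) := by ring
    simp only [weight, stepU, List.sum_cons, List.length_cons, Nat.add_sub_cancel]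
    simp only [h, spread_lagrange_rot_mul_zero]
    simp

theorem weight_succ (hP : P * (1 - C X * rot ^ 2) = 1) (hD : D * (1 - rot ^ 3) = 1)
    {l : List ℕ} (hl : l ≠ []) (q : ℕ) :
    weight P D l (q + 1) = X * weight P D (stepU l) (q + 1) + weight P D (stepT l) q := by
  match l with
  | [0] =>
    have h : rot ^ 0 * P ^ 0 * D = 1 + rot * (rot ^ 2 * P ^ 0 * D) := by
      linear_combination hD
    have h' : rot ^ 2 * P * (rot ^ 2 * P ^ 0 * D) = rot ^ (2 + 2) * P ^ 1 * D := by ring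
    simp only [weight, stepU, stepT, List.sum_cons, List.sum_nil, List.length_cons,
      List.length_nil, Nat.add_sub_cancel, add_zero, zero_add]
    simp only [h, lagrange_add, spread_add, spread_lagrange_rot_mul_succ, lagrange_one,
      spread_single, h']
    simp
  | 0 :: e :: l =>
    have h : rot ^ (0 + (e + l.sum)) * P ^ (l.length + 1) * D =
        rot ^ (e + l.sum) * P ^ l.length * D +
          C X * (rot ^ (2 + (e + l.sum)) * P ^ (l.length + 1) * D) := by
      linear_combination (rot ^ (e + l.sum) * P ^ l.length * D) * hP
    simp only [weight, stepU, stepT, List.sum_cons, List.length_cons, Nat.add_sub_cancel]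
    simp only [h, lagrange_add, spread_add, lagrange_C_mul, spread_mul, spread_succ_succ]
    ring
  | (d + 1) :: l =>
    have h : rot ^ (d + 1 + l.sum) * P ^ l.length * D =
        rot * (rot ^ (d + l.sum) * P ^ l.length * D) := by ring
    have h' : rot ^ 2 * P * (rot ^ (d + l.sum) * P ^ l.length * D) =
        rot ^ (2 + (d + l.sum)) * P ^ (l.length + 1) * D := by ring
    simp only [weight, stepU, stepT, List.sum_cons, List.length_cons, Nat.add_sub_cancel]
    simp only [h, spread_lagrange_rot_mul_succ, h']

theorem exists_mul_one_sub_eq_one {H : ℚ⟦X⟧⟦X⟧} {K : ℚ⟦X⟧}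
    (h : constantCoeff H = X * K) : ∃ P : ℚ⟦X⟧⟦X⟧, P * (1 - H) = 1 := by
  have : IsUnit (1 - H) := by
    rw [isUnit_iff_constantCoeff, isUnit_iff_constantCoeff]
    simp [h]
  exact this.exists_left_inv

end Weights

section Evaluation

open PowerSeries

theorem geom_truncated {A : Type*} [CommRing A] {P w : A} (h : P * (1 - w) = 1) (J : ℕ) :
    P = ∑ j ∈ Finset.range J, w ^ j + w ^ J * P := by
  induction J with
  | zero => simp
  | succ J ih =>
    rw [Finset.sum_range_succ]
    linear_combination ih + w ^ J * h

theorem one_sub_mul_sum_multichoose {A : Type*} [CommRing A] (w : A) (N J : ℕ) :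
    (1 - w) * ∑ s ∈ Finset.range (J + 1), ((N + 1).multichoose s : A) * w ^ s =
      ∑ s ∈ Finset.range (J + 1), (N.multichoose s : A) * w ^ s -
        (N + 1).multichoose J * w ^ (J + 1) := by
  induction J with
  | zero => simp
  | succ J ih =>
    rw [Finset.sum_range_succ, Finset.sum_range_succ _ (J + 1), mul_add, ih,
      Nat.multichoose_succ_succ]
    push_cast
    ring

theorem exists_pow_eq_sum_multichoose {A : Type*} [CommRing A] {P w : A}
    (h : P * (1 - w) = 1) (N J : ℕ) :
    ∃ E, P ^ N = ∑ s ∈ Finset.range (J + 1), (N.multichoose s : A) * w ^ s + w ^ (J + 1) * E := by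
  induction N with
  | zero => exact ⟨0, by simp [Finset.sum_range_succ']⟩
  | succ N ih =>
    obtain ⟨E, hE⟩ := ih
    refine ⟨P * ((N + 1).multichoose J + E), ?_⟩
    have h' := one_sub_mul_sum_multichoose w N J
    rw [pow_succ, hE]
    linear_combination -P * h' +
      (∑ s ∈ Finset.range (J + 1), ((N + 1).multichoose s : A) * w ^ s) * h

theorem coeff_one_add_X_pow {A : Type*} [CommRing A] (m i : ℕ) :
    coeff i ((1 + X : A⟦X⟧) ^ m) = m.choose i := by
  have h : (1 + X : A⟦X⟧) ^ m = (((1 + Polynomial.X) ^ m : Polynomial A) : A⟦X⟧) := by simp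
  rw [h, Polynomial.coeff_coe, Polynomial.coeff_one_add_X_pow]

theorem exists_lagrange_one_add_X_pow {P : ℚ⟦X⟧⟦X⟧} (hP : P * (1 - C X * rot ^ 2) = 1)
    (a N J : ℕ) :
    ∃ r, lagrange (kernel P) (N + 1) ((1 + X) ^ (a + 1)) =
      X ^ (N + 1) * (∑ s ∈ Finset.range (J + 1),
        C ((a + 1 : ℚ) / (N + 1) * (N + 1).multichoose s * (a + 2 * (N + 1) + 2 * s).choose N) *
          X ^ (3 * s) + X ^ (3 * (J + 1)) * r) := by
  obtain ⟨E, hE⟩ := exists_pow_eq_sum_multichoose hP (N + 1) J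
  have hd : d⁄dX ℚ⟦X⟧ ((1 + X : ℚ⟦X⟧⟦X⟧) ^ (a + 1)) = C (C (a + 1 : ℚ)) * (1 + X) ^ a := by
    simp [Derivation.leibniz_pow]
  have hprod : d⁄dX ℚ⟦X⟧ ((1 + X : ℚ⟦X⟧⟦X⟧) ^ (a + 1)) * kernel P ^ (N + 1) =
      C (X ^ (N + 1)) * (∑ s ∈ Finset.range (J + 1),
        C (C ((a + 1 : ℚ) * (N + 1).multichoose s) * X ^ (3 * s)) *
          (1 + X) ^ (a + 2 * (N + 1) + 2 * s) +
        C (X ^ (3 * (J + 1))) * (C (C (a + 1 : ℚ)) * (1 + X) ^ (a + 2 * (N + 1) + 2 * (J + 1)) * E))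
      := by
    rw [hd, kernel, mul_pow, hE, mul_add, mul_add, mul_add, Finset.mul_sum, Finset.mul_sum,
      Finset.mul_sum]
    congr 1
    · refine Finset.sum_congr rfl fun s _ => ?_
      simp only [rot, map_mul, map_pow, map_natCast]
      generalize (1 + X : ℚ⟦X⟧⟦X⟧) = v
      ring
    · simp only [rot, map_pow]
      generalize (1 + X : ℚ⟦X⟧⟦X⟧) = v
      ring
  refine ⟨C ((N + 1 : ℚ)⁻¹) *
    coeff N (C (C (a + 1 : ℚ)) * (1 + X) ^ (a + 2 * (N + 1) + 2 * (J + 1)) * E), ?_⟩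
  rw [lagrange, hprod, coeff_C_mul, map_add, coeff_C_mul, map_sum, smul_eq_C_mul]
  simp only [coeff_C_mul, coeff_one_add_X_pow]
  rw [mul_left_comm, mul_add, Finset.mul_sum]
  congr 2
  · refine Finset.sum_congr rfl fun s _ => ?_
    simp only [map_mul, map_natCast, div_eq_mul_inv]
    ring
  · ring

theorem exists_lagrange_kernel_eq (P H : ℚ⟦X⟧⟦X⟧) (N : ℕ) :
    ∃ r, lagrange (kernel P) (N + 1) H = X ^ (N + 1) * r := by
  refine ⟨((N + 1 : ℚ)⁻¹) • coeff N (d⁄dX ℚ⟦X⟧ H * ((1 + X) ^ 2 * P) ^ (N + 1)), ?_⟩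
  have h : d⁄dX ℚ⟦X⟧ H * kernel P ^ (N + 1) =
      C (X ^ (N + 1)) * (d⁄dX ℚ⟦X⟧ H * ((1 + X) ^ 2 * P) ^ (N + 1)) := by
    rw [kernel, mul_assoc, mul_pow (C X), map_pow]
    ring
  rw [lagrange, h, coeff_C_mul, mul_smul_comm]

theorem coeff_sum_C_mul_X_pow (c : ℕ → ℚ) (r : ℚ⟦X⟧) (J i : ℕ) (hi : i ≤ J) :
    coeff (3 * i) (∑ s ∈ Finset.range (J + 1), C (c s) * X ^ (3 * s) + X ^ (3 * (J + 1)) * r) =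
      c i := by
  rw [map_add, map_sum, coeff_X_pow_mul', if_neg (by omega), add_zero,
    Finset.sum_eq_single_of_mem i (by simpa using by omega)]
  · simp [coeff_X_pow]
  · intro s _ hs
    simp [coeff_X_pow, hs.symm]

theorem coeff_weight_succ {P D : ℚ⟦X⟧⟦X⟧} (hP : P * (1 - C X * rot ^ 2) = 1)
    (hD : D * (1 - rot ^ 3) = 1) (k N : ℕ) :
    coeff (3 * k + 2 + (N + 1)) (weight P D [2] (2 * (N + 1))) =
      ∑ s ∈ Finset.range (k + 1), (3 * ((k : ℚ) - s) + 2) / (N + 1) * (N + 1).multichoose s *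
        (3 * k + 1 + 2 * (N + 1) - s).choose N := by
  have hsum : rot ^ [2].sum * P ^ ([2].length - 1) * D =
      ∑ j ∈ Finset.range (k + 1), C (X ^ (3 * j + 2)) * (1 + X) ^ (3 * j + 1 + 1) +
        C (X ^ (3 * (k + 1) + 2)) * ((1 + X) ^ (3 * (k + 1) + 2) * D) := by
    have h := geom_truncated hD (k + 1)
    have hr : [2].sum = 2 := rfl
    have hl : [2].length - 1 = 0 := rfl
    rw [hr, hl, pow_zero, mul_one]
    conv_lhs => rw [h]
    rw [mul_add, Finset.mul_sum]
    congr 1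
    · refine Finset.sum_congr rfl fun j _ => ?_
      simp only [rot, map_pow]
      generalize (1 + X : ℚ⟦X⟧⟦X⟧) = v
      ring
    · simp only [rot, map_pow]
      generalize (1 + X : ℚ⟦X⟧⟦X⟧) = v
      ring
  rw [weight, hsum]
  simp only [List.length_cons, List.length_nil, Nat.add_sub_cancel]
  rw [spread_zero_two_mul, lagrange_add, lagrange_sum, map_add, map_sum]
  simp only [lagrange_C_mul]
  obtain ⟨r, hr⟩ := exists_lagrange_kernel_eq P ((1 + X) ^ (3 * (k + 1) + 2) * D) N
  rw [hr, ← mul_assoc, ← pow_add, coeff_X_pow_mul', if_neg (by omega), add_zero,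
    ← Finset.sum_range_reflect]
  refine Finset.sum_congr rfl fun s hs => ?_
  rw [Finset.mem_range] at hs
  obtain ⟨j, rfl⟩ : ∃ j, k = s + j := ⟨k - s, by omega⟩
  obtain ⟨r, hr⟩ := exists_lagrange_one_add_X_pow hP (3 * j + 1) N (s + j)
  have hj : s + j + 1 - 1 - s = j := by omega
  have hdeg : 3 * (s + j) + 2 + (N + 1) = 3 * s + (3 * j + 2 + (N + 1)) := by ring
  rw [hj, hr, ← mul_assoc, ← pow_add, hdeg, coeff_X_pow_mul,
    coeff_sum_C_mul_X_pow _ _ _ _ (by omega)]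
  have htop : 3 * j + 1 + 2 * (N + 1) + 2 * s = 3 * (s + j) + 1 + 2 * (N + 1) - s := by omega
  rw [htop]
  push_cast
  ring

theorem coeff_weight_zero {P D : ℚ⟦X⟧⟦X⟧} (hD : D * (1 - rot ^ 3) = 1) (k : ℕ) :
    coeff (3 * k + 2) (weight P D [2] 0) = 1 := by
  have hw : weight P D [2] 0 = X ^ 2 * constantCoeff D := by
    simp [weight, spread, lagrange, rot]
  have h : constantCoeff D * (1 - X ^ 3) = 1 := by
    simpa [rot] using congrArg constantCoeff hD
  rw [hw, coeff_X_pow_mul, geom_truncated h (k + 1)]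
  have := coeff_sum_C_mul_X_pow (fun _ => 1) (constantCoeff D) k k le_rfl
  simpa [pow_mul] using this

end Evaluation

section Matrices

open Matrix

/-- The matrix of order two modulo sign. -/
def S : Matrix (Fin 2) (Fin 2) ℤ := !![0, -1; 1, 0]

/-- The elementary parabolic matrix. -/
def T : Matrix (Fin 2) (Fin 2) ℤ := !![1, 1; 0, 1]

theorem M_add_one (a : ℤ) : M (a + 1) = T * M a := by
  simp [M, T]

theorem M_one_mul_S : M 1 * S = -T := by
  simp [M, S, T]

theorem S_mul_S : S * S = -1 := by
  simp [S, one_fin_two]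

theorem M_one_pow_three : M 1 ^ 3 = -1 := by
  simp [M, pow_succ, one_fin_two]

theorem M_one_pow_two : M 1 ^ 2 = !![0, -1; 1, -1] := by
  simp [M, pow_succ]

theorem M_one_pow_six : M 1 ^ 6 = 1 := by
  rw [show 6 = 3 * 2 from rfl, pow_mul, M_one_pow_three]
  simp

/-- The matrix of the entrance vertex of the current triangle. -/
def base : List ℕ → Matrix (Fin 2) (Fin 2) ℤ
  | [] => 1
  | e :: l => base l * M 1 ^ (2 + 2 * e) * S

/-- The matrix (modulo sign) of the current vertex. -/
def toMatrix : List ℕ → Matrix (Fin 2) (Fin 2) ℤ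
  | [] => 1
  | d :: l => base l * M 1 ^ (2 + 2 * d)

/-- Validity of the part of a state below the current triangle. -/
def ValidTail : List ℕ → Prop
  | [] => True
  | [e] => e ≤ 2
  | e :: e' :: l => e ≤ 1 ∧ ValidTail (e' :: l)

/-- Validity of a state. -/
def Valid : List ℕ → Prop
  | [] => False
  | d :: l => d ≤ 2 ∧ ValidTail l

theorem Valid.ne_nil {l : List ℕ} (h : Valid l) : l ≠ [] := by
  rintro rfl
  exact h

theorem Valid.stepU {l : List ℕ} (h : Valid l) : Valid (stepU l) := by
  match l with
  | 0 :: l => exact ⟨le_rfl, h.2⟩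
  | (d + 1) :: l => exact ⟨(Nat.le_succ d).trans h.1, h.2⟩

theorem Valid.stepT {l : List ℕ} (h : Valid l) : Valid (stepT l) := by
  match l with
  | [0] => exact ⟨le_rfl, le_refl 2⟩
  | [0, e] => exact ⟨h.2, trivial⟩
  | 0 :: e :: e' :: l => exact ⟨h.2.1.trans one_le_two, h.2.2⟩
  | [d + 1] => exact ⟨le_rfl, (Nat.le_succ d).trans h.1⟩
  | (d + 1) :: e :: l => exact ⟨le_rfl, Nat.le_of_succ_le_succ h.1, h.2⟩

theorem toMatrix_stepU {l : List ℕ} (h : l ≠ []) :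
    toMatrix l * M 1 = toMatrix (stepU l) ∨ toMatrix l * M 1 = -toMatrix (stepU l) := by
  match l with
  | 0 :: l =>
    right
    simp only [toMatrix, stepU]
    rw [mul_assoc, ← pow_succ, show 2 + 2 * 0 + 1 = 3 from rfl, show 2 + 2 * 2 = 6 from rfl,
      M_one_pow_three, M_one_pow_six]
    simp
  | (d + 1) :: l =>
    right
    simp only [toMatrix, stepU]
    rw [mul_assoc, ← pow_succ, show 2 + 2 * (d + 1) + 1 = 2 + 2 * d + 3 by ring, pow_add _ _ 3,
      M_one_pow_three]
    simp

theorem toMatrix_stepT {l : List ℕ} (h : l ≠ []) :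
    toMatrix l * T = toMatrix (stepT l) ∨ toMatrix l * T = -toMatrix (stepT l) := by
  have hT : T = -(M 1 * S) := by rw [M_one_mul_S, neg_neg]
  match l with
  | [0] =>
    left
    simp only [toMatrix, stepT, base, hT, one_mul]
    rw [mul_neg, ← mul_assoc, ← pow_succ, show 2 + 2 * 0 + 1 = 3 from rfl,
      show 2 + 2 * 2 = 6 from rfl, M_one_pow_three, M_one_pow_six]
    simp
  | 0 :: e :: l =>
    right
    simp only [toMatrix, stepT, base, hT]
    rw [mul_neg, ← mul_assoc, mul_assoc _ (M 1 ^ (2 + 2 * 0)), ← pow_succ,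
      show 2 + 2 * 0 + 1 = 3 from rfl, M_one_pow_three]
    simp [mul_assoc, S_mul_S]
  | (d + 1) :: l =>
    left
    simp only [toMatrix, stepT, base, hT]
    rw [mul_neg, ← mul_assoc, mul_assoc _ (M 1 ^ (2 + 2 * (d + 1))), ← pow_succ,
      show 2 + 2 * (d + 1) + 1 = 2 + 2 * d + 3 by ring, pow_add _ _ 3,
      M_one_pow_three, show 2 + 2 * 2 = 6 from rfl, M_one_pow_six]
    simp

theorem exists_base_eq (l : List ℕ) (hl : ValidTail l) (h : l ≠ []) :
    ∃ (r : ℕ) (a b c d : ℤ), 0 ≤ a ∧ 0 ≤ b ∧ 0 ≤ c ∧ 0 ≤ d ∧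
      (base l = M 1 ^ r * (S * !![a, b; c, d]) ∨ base l = -(M 1 ^ r * (S * !![a, b; c, d]))) := by
  match l with
  | [e] =>
    refine ⟨2 + 2 * e, 1, 0, 0, 1, by norm_num, le_rfl, le_rfl, by norm_num, Or.inl ?_⟩
    rw [← one_fin_two]
    simp [base]
  | e :: e' :: l =>
    obtain ⟨r, a, b, c, d, ha, hb, hc, hd, hB⟩ := exists_base_eq (e' :: l) hl.2 (by simp)
    have he : e = 0 ∨ e = 1 := by have := hl.1; omega
    rw [base]
    generalize base (e' :: l) = B at hB
    rcases he with rfl | rfl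
    · have hL : M 1 ^ (2 + 2 * 0) * S = -!![1, 0; 1, 1] := by simp [M_one_pow_two, S]
      refine ⟨r, a + b, b, c + d, d, by positivity, hb, by positivity, hd, ?_⟩
      have hprod : !![a + b, b; c + d, d] = !![a, b; c, d] * !![1, 0; 1, 1] := by simp
      rw [mul_assoc, hL, hprod]
      rcases hB with rfl | rfl <;> simp only [mul_assoc, mul_neg, neg_mul, neg_neg] <;> tauto
    · have hL : M 1 ^ (2 + 2 * 1) * S = T := by
        rw [show 2 + 2 * 1 = 3 + 1 from rfl, pow_succ, M_one_pow_three, mul_assoc, M_one_mul_S]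
        simp
      refine ⟨r, a, a + b, c, c + d, ha, by positivity, hc, by positivity, ?_⟩
      have hprod : !![a, a + b; c, c + d] = !![a, b; c, d] * T := by simp [T]
      rw [mul_assoc, hL, hprod]
      rcases hB with rfl | rfl <;> simp only [mul_assoc, neg_mul] <;> tauto

theorem M_one_pow_cases (c : ℕ) :
    (M 1 ^ c = 1 ∨ M 1 ^ c = M 1 ∨ M 1 ^ c = !![0, -1; 1, -1]) ∨
      (M 1 ^ c = -1 ∨ M 1 ^ c = -M 1 ∨ M 1 ^ c = -!![0, -1; 1, -1]) := by
  rw [← M_one_pow_two]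
  induction c with
  | zero => simp
  | succ c ih =>
    have h3 : M 1 ^ 2 * M 1 = -1 := by rw [← pow_succ, M_one_pow_three]
    rw [pow_succ]
    rcases ih with (h | h | h) | (h | h | h) <;> rw [h]
    · simp
    · simp [sq]
    · simp [h3]
    · simp
    · simp [sq]
    · simp [h3]

theorem S_mul_ne_M_one_pow {a b c d : ℤ} (hb : 0 ≤ b) (hc : 0 ≤ c) (hd : 0 ≤ d)
    (m : ℕ) : S * !![a, b; c, d] ≠ M 1 ^ m := by
  intro h
  have hS : S * !![a, b; c, d] = !![-c, -d; a, b] := by simp [S]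
  rw [hS] at h
  rcases M_one_pow_cases m with (h' | h' | h') | (h' | h' | h') <;> rw [h'] at h <;>
    simp [M, one_fin_two] at h <;> omega

theorem toMatrix_mul_M_one_iff {l : List ℕ} (hl : Valid l) :
    (toMatrix l * M 1 = 1 ∨ toMatrix l * M 1 = -1) ↔ l = [0] := by
  match l with
  | [d] =>
    have hd : d ≤ 2 := hl.1
    have h3 := M_one_pow_three
    have h5 : M 1 ^ 5 = -M 1 ^ 2 := by
      rw [show 5 = 3 + 2 from rfl, pow_add, h3, neg_one_mul]
    have h7 : M 1 ^ 7 = M 1 := by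
      rw [show 7 = 6 + 1 from rfl, pow_succ, M_one_pow_six, one_mul]
    simp only [toMatrix, base, one_mul, ← pow_succ]
    interval_cases d
    · exact iff_of_true (Or.inr h3) rfl
    · refine iff_of_false ?_ (by simp)
      rw [show 2 + 2 * 1 + 1 = 5 from rfl, h5, M_one_pow_two]
      simp [one_fin_two]
    · refine iff_of_false ?_ (by simp)
      rw [show 2 + 2 * 2 + 1 = 7 from rfl, h7]
      simp [M, one_fin_two]
  | d :: e :: l =>
    obtain ⟨r, a, b, c, d', -, hb, hc, hd, h⟩ := exists_base_eq (e :: l) hl.2 (by simp)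
    simp only [List.cons.injEq, reduceCtorEq, and_false, iff_false]
    intro h'
    have hinv : ∀ m, M 1 ^ m * M 1 ^ (5 * m) = 1 ∧ M 1 ^ (5 * m) * M 1 ^ m = 1 := by
      intro m
      rw [← pow_add, ← pow_add, show m + 5 * m = 6 * m by ring, show 5 * m + m = 6 * m by ring,
        pow_mul, M_one_pow_six, one_pow]
      exact ⟨rfl, rfl⟩
    have hne := S_mul_ne_M_one_pow (a := a) hb hc hd
    rw [toMatrix, mul_assoc, ← pow_succ] at h'
    set m := 2 + 2 * d + 1
    generalize S * !![a, b; c, d'] = Q at h hne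
    have hQ : ∀ ε : Matrix (Fin 2) (Fin 2) ℤ, M 1 ^ r * Q * M 1 ^ m = ε →
        Q = M 1 ^ (5 * r) * ε * M 1 ^ (5 * m) := by
      rintro _ rfl
      simp only [mul_assoc, (hinv m).1, mul_one]
      rw [← mul_assoc, (hinv r).2, one_mul]
    have hε : M 1 ^ r * Q * M 1 ^ m = 1 ∨ M 1 ^ r * Q * M 1 ^ m = -1 := by
      rcases h with h | h <;> rw [h] at h' <;> simpa [neg_eq_iff_eq_neg, or_comm] using h'
    rcases hε with h | h
    · exact hne (5 * r + 5 * m) (by rw [hQ _ h, mul_one, pow_add])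
    · refine hne (5 * r + 3 + 5 * m) (by rw [hQ _ h, pow_add, pow_add, M_one_pow_three])

end Matrices

section Counting

/-- Tuples `a` of `p` positive integers of sum `p + q` with `A * M (a 0) * ⋯ = ±1`. -/
def solutions (p q : ℕ) (A : Matrix (Fin 2) (Fin 2) ℤ) : Set (Fin p → ℤ) :=
  {a | (∀ i, 0 < a i) ∧ (A * (List.ofFn fun i => M (a i)).prod = 1 ∨
    A * (List.ofFn fun i => M (a i)).prod = -1) ∧ ∑ i, a i = p + q}

theorem solutions_neg (p q : ℕ) (A : Matrix (Fin 2) (Fin 2) ℤ) :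
    solutions p q (-A) = solutions p q A := by
  ext a
  simp only [solutions, Set.mem_ofPred_eq, neg_mul, neg_eq_iff_eq_neg, neg_neg, or_comm]

theorem solutions_zero (q : ℕ) (A : Matrix (Fin 2) (Fin 2) ℤ) :
    solutions 0 q A = {_a | (A = 1 ∨ A = -1) ∧ q = 0} := by
  ext a
  simp [solutions, eq_comm]

theorem cons_mem_solutions (p q : ℕ) (A : Matrix (Fin 2) (Fin 2) ℤ) (c : ℤ) (b : Fin p → ℤ) :
    (Fin.cons c b : Fin (p + 1) → ℤ) ∈ solutions (p + 1) q A ↔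
      0 < c ∧ (∀ i, 0 < b i) ∧ (A * M c * (List.ofFn fun i => M (b i)).prod = 1 ∨
        A * M c * (List.ofFn fun i => M (b i)).prod = -1) ∧ c + ∑ i, b i = p + 1 + q := by
  simp [solutions, Fin.forall_fin_succ, Fin.sum_univ_succ, List.ofFn_succ, mul_assoc, and_assoc]

theorem le_sum_of_pos {p : ℕ} {b : Fin p → ℤ} (hb : ∀ i, 0 < b i) : (p : ℤ) ≤ ∑ i, b i := by
  simpa using Finset.card_nsmul_le_sum Finset.univ b 1 fun i _ => hb i

theorem solutions_succ_zero (p : ℕ) (A : Matrix (Fin 2) (Fin 2) ℤ) :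
    solutions (p + 1) 0 A =
      Fin.cons (α := fun _ => ℤ) 1 '' solutions p 0 (A * M 1) := by
  ext a
  obtain ⟨c, b, rfl⟩ : ∃ c b, a = Fin.cons c b := ⟨a 0, Fin.tail a, (Fin.cons_self_tail a).symm⟩
  rw [cons_mem_solutions]
  constructor
  · rintro ⟨hc, hb, hprod, hsum⟩
    have := le_sum_of_pos hb
    push_cast at hsum
    obtain rfl : c = 1 := by omega
    exact ⟨b, ⟨hb, hprod, by push_cast; omega⟩, rfl⟩
  · rintro ⟨b', ⟨hb, hprod, hsum⟩, h⟩
    obtain ⟨rfl, rfl⟩ := Fin.cons_inj.mp h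
    exact ⟨one_pos, hb, hprod, by rw [hsum]; push_cast; ring⟩

/-- Incrementing the first entry of a tuple. -/
def incHead {p : ℕ} (a : Fin (p + 1) → ℤ) : Fin (p + 1) → ℤ := Fin.cons (a 0 + 1) (Fin.tail a)

theorem incHead_cons {p : ℕ} (c : ℤ) (b : Fin p → ℤ) :
    incHead (Fin.cons c b) = Fin.cons (c + 1) b := by
  simp [incHead]

theorem incHead_injective (p : ℕ) : Function.Injective (incHead (p := p)) := by
  intro a b h
  obtain ⟨h0, ht⟩ := Fin.cons_inj.mp h
  rw [← Fin.cons_self_tail a, ← Fin.cons_self_tail b, ht, add_right_cancel h0]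

theorem solutions_succ_succ (p q : ℕ) (A : Matrix (Fin 2) (Fin 2) ℤ) :
    solutions (p + 1) (q + 1) A =
      Fin.cons (α := fun _ => ℤ) 1 '' solutions p (q + 1) (A * M 1) ∪
        incHead '' solutions (p + 1) q (A * T) := by
  ext a
  obtain ⟨c, b, rfl⟩ : ∃ c b, a = Fin.cons c b := ⟨a 0, Fin.tail a, (Fin.cons_self_tail a).symm⟩
  rw [cons_mem_solutions]
  constructor
  · rintro ⟨hc, hb, hprod, hsum⟩
    push_cast at hsum
    by_cases hc1 : c = 1
    · subst hc1
      exact Or.inl ⟨b, ⟨hb, hprod, by push_cast; omega⟩, rfl⟩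
    · refine Or.inr ⟨Fin.cons (c - 1) b, ?_, by rw [incHead_cons, sub_add_cancel]⟩
      rw [cons_mem_solutions, mul_assoc A, ← M_add_one, sub_add_cancel]
      exact ⟨by omega, hb, hprod, by omega⟩
  · rintro (⟨b', ⟨hb, hprod, hsum⟩, h⟩ | ⟨a', ha', h⟩)
    · obtain ⟨rfl, rfl⟩ := Fin.cons_inj.mp h
      exact ⟨one_pos, hb, hprod, by rw [hsum]; push_cast; ring⟩
    · obtain ⟨c', b', rfl⟩ : ∃ c b, a' = Fin.cons c b :=
        ⟨a' 0, Fin.tail a', (Fin.cons_self_tail a').symm⟩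
      rw [incHead_cons] at h
      obtain ⟨rfl, rfl⟩ := Fin.cons_inj.mp h
      rw [cons_mem_solutions, mul_assoc A, ← M_add_one] at ha'
      obtain ⟨hc, hb, hprod, hsum⟩ := ha'
      exact ⟨by omega, hb, hprod, by push_cast; omega⟩

theorem finite_solutions (p q : ℕ) (A : Matrix (Fin 2) (Fin 2) ℤ) : (solutions p q A).Finite := by
  induction p generalizing q A with
  | zero => exact Set.toFinite _
  | succ p ihp =>
    induction q generalizing A with
    | zero =>
      rw [solutions_succ_zero]
      exact (ihp 0 _).image _
    | succ q ihq =>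
      rw [solutions_succ_succ]
      exact ((ihp _ _).image _).union ((ihq _).image _)

theorem ncard_solutions_zero (q : ℕ) (A : Matrix (Fin 2) (Fin 2) ℤ) :
    (solutions 0 q A).ncard = if (A = 1 ∨ A = -1) ∧ q = 0 then 1 else 0 := by
  rw [solutions_zero]
  split_ifs with h <;> simp [h]

theorem ncard_solutions_succ_zero (p : ℕ) (A : Matrix (Fin 2) (Fin 2) ℤ) :
    (solutions (p + 1) 0 A).ncard = (solutions p 0 (A * M 1)).ncard := by
  rw [solutions_succ_zero, Set.ncard_image_of_injective _ (Fin.cons_right_injective _)]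

theorem ncard_solutions_succ_succ (p q : ℕ) (A : Matrix (Fin 2) (Fin 2) ℤ) :
    (solutions (p + 1) (q + 1) A).ncard =
      (solutions p (q + 1) (A * M 1)).ncard + (solutions (p + 1) q (A * T)).ncard := by
  rw [solutions_succ_succ, Set.ncard_union_eq _ ((finite_solutions _ _ _).image _)
      ((finite_solutions _ _ _).image _),
    Set.ncard_image_of_injective _ (Fin.cons_right_injective _),
    Set.ncard_image_of_injective _ (incHead_injective p)]
  rw [Set.disjoint_left]
  rintro _ ⟨b, -, rfl⟩ ⟨a, ha, h⟩
  have h0 : a 0 + 1 = 1 := (Fin.cons_inj.mp h).1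
  have := ha.1 0
  omega

theorem solutions_congr {A B : Matrix (Fin 2) (Fin 2) ℤ} (h : A = B ∨ A = -B) (p q : ℕ) :
    solutions p q A = solutions p q B := by
  rcases h with rfl | rfl
  · rfl
  · exact solutions_neg p q B

open PowerSeries in
theorem ncard_solutions_eq_coeff_weight {P D : ℚ⟦X⟧⟦X⟧} (hP : P * (1 - C X * rot ^ 2) = 1)
    (hD : D * (1 - rot ^ 3) = 1) (p q : ℕ) {l : List ℕ} (hl : Valid l) :
    ((solutions (p + 1) q (toMatrix l)).ncard : ℚ) = coeff p (weight P D l q) := by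
  induction p generalizing q l with
  | zero =>
    induction q generalizing l with
    | zero =>
      rw [ncard_solutions_succ_zero, ncard_solutions_zero, weight_zero hP hD hl.ne_nil, map_add,
        coeff_zero_X_mul]
      simp only [toMatrix_mul_M_one_iff hl, and_true]
      split_ifs <;> simp
    | succ q ih =>
      rw [ncard_solutions_succ_succ, ncard_solutions_zero, weight_succ hP hD hl.ne_nil, map_add,
        coeff_zero_X_mul, solutions_congr (toMatrix_stepT hl.ne_nil), ← ih hl.stepT]
      simp
  | succ p ihp =>
    induction q generalizing l with
    | zero =>
      rw [ncard_solutions_succ_zero, solutions_congr (toMatrix_stepU hl.ne_nil), ihp _ hl.stepU,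
        weight_zero hP hD hl.ne_nil, map_add, coeff_succ_X_mul]
      split_ifs <;> simp
    | succ q ih =>
      rw [ncard_solutions_succ_succ, solutions_congr (toMatrix_stepT hl.ne_nil),
        solutions_congr (toMatrix_stepU hl.ne_nil), Nat.cast_add, ihp _ hl.stepU, ih hl.stepT,
        weight_succ hP hD hl.ne_nil, map_add, coeff_succ_X_mul]

end Counting

open PowerSeries in
theorem exists_ncard_eq_coeff_weight : ∃ P D : ℚ⟦X⟧⟦X⟧,
    P * (1 - C X * rot ^ 2) = 1 ∧ D * (1 - rot ^ 3) = 1 ∧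
      ∀ p q, ((solutions (p + 1) q 1).ncard : ℚ) = coeff p (weight P D [2] q) := by
  obtain ⟨P, hP⟩ := exists_mul_one_sub_eq_one (H := C X * rot ^ 2) (K := X ^ 2) (by simp [rot])
  obtain ⟨D, hD⟩ := exists_mul_one_sub_eq_one (H := rot ^ 3) (K := X ^ 2)
    (by simp [rot, ← pow_succ'])
  refine ⟨P, D, hP, hD, fun p q => ?_⟩
  have h2 : toMatrix [2] = 1 := by
    simp only [toMatrix, base, one_mul]
    exact M_one_pow_six
  rw [← h2]
  exact ncard_solutions_eq_coeff_weight hP hD p q ⟨le_rfl, trivial⟩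

theorem ncard_solutions_base (k : ℕ) : ((solutions (3 * k + 3) 0 1).ncard : ℚ) = 1 := by
  obtain ⟨P, D, -, hD, h⟩ := exists_ncard_eq_coeff_weight
  rw [h, coeff_weight_zero hD]

theorem ncard_solutions_step (k N : ℕ) :
    ((solutions (3 * k + N + 4) (2 * (N + 1)) 1).ncard : ℚ) =
      ∑ s ∈ Finset.range (k + 1), (3 * ((k : ℚ) - s) + 2) / (N + 1) * (N + 1).multichoose s *
        (3 * k + 1 + 2 * (N + 1) - s).choose N := by
  obtain ⟨P, D, hP, hD, h⟩ := exists_ncard_eq_coeff_weight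
  rw [← coeff_weight_succ hP hD, ← h]
  rw [show 3 * k + 2 + (N + 1) + 1 = 3 * k + N + 4 by ring]

end Quiddity

theorem stmt2 (n k : ℕ) (hn : 1 ≤ n) (hk : 3 * k < n) :
    (Set.ncard {a : Fin (n + 2) → ℤ | (∀ i, 0 < a i) ∧
        ((List.ofFn fun i => M (a i)).prod = 1 ∨
          (List.ofFn fun i => M (a i)).prod = -1) ∧
        (∑ i, a i) = 3 * ((n : ℤ) - 2 * k)} : ℚ) =
    ∑ s ∈ Finset.range (k + 1),
      ((3 * ((k : ℚ) - s) + 2) / ((n : ℚ) - s + 1)) *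
        Cq ((n : ℤ) - 3 * k + s - 2) s *
        Cq (2 * (n : ℤ) - 3 * k - s - 1) (n - 3 * k - 1) := by
  obtain ⟨N, rfl⟩ : ∃ N, n = 3 * k + N + 1 := ⟨n - 3 * k - 1, by omega⟩
  have hset : {a : Fin (3 * k + N + 1 + 2) → ℤ | (∀ i, 0 < a i) ∧
        ((List.ofFn fun i => M (a i)).prod = 1 ∨
          (List.ofFn fun i => M (a i)).prod = -1) ∧
        (∑ i, a i) = 3 * (((3 * k + N + 1 : ℕ) : ℤ) - 2 * k)} =
      Quiddity.solutions (3 * k + N + 3) (2 * N) 1 := by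
    ext a
    have hsum : 3 * (((3 * k + N + 1 : ℕ) : ℤ) - 2 * k) =
        (3 * k + N + 3 : ℕ) + (2 * N : ℕ) := by push_cast; ring
    simp only [Quiddity.solutions, one_mul, hsum]
  rw [hset]
  have hsub : 3 * k + N + 1 - 3 * k - 1 = N := by omega
  rw [hsub]
  cases N with
  | zero =>
    rw [Quiddity.ncard_solutions_base, Finset.sum_eq_single_of_mem 0 (by simp)]
    · have h : (3 * (k : ℚ) + 2) ≠ 0 := by positivity
      simp [Cq]
      field_simp
      ring
    · intro s _ hs
      obtain ⟨s, rfl⟩ := Nat.exists_eq_succ_of_ne_zero hs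
      have h : Cq (((3 * k + 0 + 1 : ℕ) : ℤ) - 3 * k + (s + 1 : ℕ) - 2) (s + 1) = 0 := by
        have h1 : ((3 * k + 0 + 1 : ℕ) : ℤ) - 3 * k + (s + 1 : ℕ) - 2 = (s : ℕ) := by
          push_cast; ring
        rw [h1, Cq, if_pos (by positivity), Int.toNat_natCast,
          Nat.choose_eq_zero_of_lt (Nat.lt_succ_self s), Nat.cast_zero]
      rw [h, mul_zero, zero_mul]
  | succ N =>
    rw [show 3 * k + (N + 1) + 3 = 3 * k + N + 4 by ring, Quiddity.ncard_solutions_step]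
    refine Finset.sum_congr rfl fun s hs => ?_
    rw [Finset.mem_range] at hs
    obtain ⟨j, rfl⟩ : ∃ j, k = s + j := ⟨k - s, by omega⟩
    have h1 : ((3 * (s + j) + (N + 1) + 1 : ℕ) : ℤ) - 3 * (s + j : ℕ) + s - 2 = (N + s : ℕ) := by
      push_cast; ring
    have h2 : 2 * ((3 * (s + j) + (N + 1) + 1 : ℕ) : ℤ) - 3 * (s + j : ℕ) - s - 1 =
        (2 * N + 3 + 2 * s + 3 * j : ℕ) := by
      push_cast; ring
    have h3 : 3 * (s + j) + 1 + 2 * (N + 1) - s = 2 * N + 3 + 2 * s + 3 * j := by omega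
    have h4 : N + 1 + s - 1 = N + s := by omega
    have h5 := Nat.choose_succ_right_eq (2 * N + 3 + 2 * s + 3 * j) N
    have h6 : 2 * N + 3 + 2 * s + 3 * j - N = N + 3 + 2 * s + 3 * j := by omega
    rw [h6] at h5
    have h7 : (((2 * N + 3 + 2 * s + 3 * j).choose (N + 1) : ℕ) : ℚ) * (N + 1) =
        ((2 * N + 3 + 2 * s + 3 * j).choose N : ℕ) * (N + 3 + 2 * s + 3 * j) := by
      exact_mod_cast h5
    have h8 : ((3 * (s + j) + (N + 1) + 1 : ℕ) : ℚ) - s + 1 = N + 3 + 2 * s + 3 * j := by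
      push_cast; ring
    rw [h1, h2, h3, h8, Nat.multichoose_eq, h4, Cq, Cq, if_pos (by positivity),
      if_pos (by positivity), Int.toNat_natCast, Int.toNat_natCast]
    have h9 : (N : ℚ) + 1 ≠ 0 := by positivity
    have h10 : (N : ℚ) + 3 + 2 * s + 3 * j ≠ 0 := by positivity
    push_cast
    field_simp
    linear_combination -((3 * j + 2) * ((N + s).choose s : ℚ)) * h7
end

section
/- Let P ∈ ℚ[[z]] be the formal power series satisfying (P − 1)·(1 − z³·P²) = z·P² (such a series exists and is unique, and has constant coefficient 1). For n ≥ 1 let Q_n be the number of tuples (a_1, …, a_{n+2}) of positive integers with M(a_1)···M(a_{n+2}) = Id or −Id, and set Q_0 := 1. Then the formal power series Q(z) = Σ_{n≥0} Q_n zⁿ satisfies (Q − 1)·(1 − z³·P³) = z·P². -/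
/-- `Qn n` is the number of tuples of `n + 2` positive integers whose associated
product of matrices `M(aᵢ)` is `Id` or `-Id`, with the convention `Qn 0 = 1`. -/
noncomputable def Qn (n : ℕ) : ℕ :=
  if n = 0 then 1 else
    Set.ncard {a : Fin (n + 2) → ℤ | (∀ i, 0 < a i) ∧
      ((List.ofFn fun i => M (a i)).prod = 1 ∨
        (List.ofFn fun i => M (a i)).prod = -1)}

/-- Normal forms for `PSL₂(ℤ) ≅ ℤ/2 * ℤ/3`: `base c` stands for `Uᶜ`, and `up c r` for
`r * S * Uᶜ`, where `U = M 1` and `S = M 0`. -/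
inductive NormalForm
  | base (c : Fin 3)
  | up (c : Fin 3) (r : NormalForm)
  deriving DecidableEq

namespace NormalForm

/-- Right multiplication by `U`. -/
def rot : NormalForm → NormalForm
  | base c => base (c + 1)
  | up c r => up (c + 1) r

/-- Right multiplication by `S`. -/
def flip : NormalForm → NormalForm
  | base c => up 0 (base c)
  | up c r => if c = 0 then r else up 0 (up c r)

/-- Right multiplication by `M (b + 1) = ± (U * S) ^ b * U`. -/
def act (s : NormalForm) : ℕ → NormalForm
  | 0 => rot s
  | b + 1 => act (flip (rot s)) b

/-- Successive right multiplication by `M (b + 1)` for `b` in a list. -/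
def run (s : NormalForm) (l : List ℕ) : NormalForm := l.foldl act s

/-- The lists of length `N` leading from `s` to the identity. -/
def solutions (N : ℕ) (s : NormalForm) : Set (List ℕ) :=
  {l | l.length = N ∧ run s l = base 0}

lemma solutions_succ (N : ℕ) (s : NormalForm) :
    solutions (N + 1) s = (fun l => 0 :: l) '' solutions N (rot s) ∪
      List.modifyHead (· + 1) '' solutions (N + 1) (flip (rot s)) := by
  ext l
  constructor
  · rintro ⟨hl, hr⟩
    match l, hl, hr with
    | 0 :: l, hl, hr => exact Or.inl ⟨l, ⟨by simpa using hl, hr⟩, rfl⟩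
    | (b + 1) :: l, hl, hr => exact Or.inr ⟨b :: l, ⟨by simpa using hl, hr⟩, rfl⟩
  · rintro (⟨l, ⟨hl, hr⟩, rfl⟩ | ⟨l, ⟨hl, hr⟩, rfl⟩)
    · exact ⟨by simpa using hl, hr⟩
    · match l, hl, hr with
      | b :: l, hl, hr => exact ⟨by simpa using hl, hr⟩

/-! ### A potential bounding the length of solutions -/

/-- The contribution of an exponent to the potential. -/
def weight : Fin 3 → ℤ := ![0, 4, 2]

/-- A potential that grows under `rot ∘ flip` and drops by at most two under `rot`. -/
def potential : NormalForm → ℤ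
  | base c => weight c
  | up c r => weight c - 3 + potential r

lemma weight_le_add_one (c : Fin 3) : weight c ≤ weight (c + 1) + 2 := by
  revert c; decide

lemma potential_le_rot (s : NormalForm) : potential s ≤ potential (rot s) + 2 := by
  cases s with
  | base c => exact weight_le_add_one c
  | up c r => have := weight_le_add_one c; simp only [rot, potential]; omega

lemma potential_lt_rot_flip (s : NormalForm) :
    potential s + 1 ≤ potential (rot (flip s)) := by
  have h1 : weight (0 + 1) = 4 := rfl
  have h0 : weight 0 = 0 := rfl
  cases s with
  | base c => simp only [flip, rot, potential]; omega
  | up c r =>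
    by_cases hc : c = 0
    · subst hc
      have := potential_le_rot r
      simp only [flip, potential, if_true]; omega
    · simp only [flip, if_neg hc, rot, potential]; omega

lemma potential_le_of_run_eq (l : List ℕ) : ∀ (b : ℕ) (s : NormalForm),
    run s (b :: l) = base 0 → potential (rot s) ≤ 3 * l.length := by
  induction l with
  | nil =>
    intro b
    induction b with
    | zero =>
      intro s h
      have h' : rot s = base 0 := h
      rw [h']; rfl
    | succ b ih =>
      intro s h
      have := ih (flip (rot s)) h
      have := potential_lt_rot_flip (rot s)
      omega
  | cons b' l ihl =>
    intro b
    induction b with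
    | zero =>
      intro s h
      have := ihl b' (rot s) h
      have := potential_le_rot (rot s)
      push_cast [List.length_cons]; omega
    | succ b ih =>
      intro s h
      have := ih (flip (rot s)) h
      have := potential_lt_rot_flip (rot s)
      omega

lemma solutions_eq_empty {N : ℕ} {s : NormalForm} (h : 3 * (N : ℤ) < potential (rot s)) :
    solutions (N + 1) s = ∅ := by
  rw [Set.eq_empty_iff_forall_notMem]
  rintro l ⟨hl, hr⟩
  match l, hl, hr with
  | b :: l, hl, hr =>
    have h1 := potential_le_of_run_eq l b s hr
    have h2 : l.length = N := by simpa using hl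
    rw [h2] at h1; omega

/-! ### Generating functions -/

open PowerSeries

/-- Generating function of the excursions that start at exponent `c` above the base level. -/
noncomputable def upSeries (P : ℚ⟦X⟧) : Fin 3 → ℚ⟦X⟧ :=
  ![1 + X ^ 2 * (P - 1), X * (P - 1), X * P * (1 + X ^ 2 * (P - 1))]

/-- Generating function of the closing paths that start at exponent `c` at the base level. -/
noncomputable def baseSeries (P : ℚ⟦X⟧) : Fin 3 → ℚ⟦X⟧ :=
  ![(1 - (X * P) ^ 3)⁻¹, (X * P) ^ 2 * (1 - (X * P) ^ 3)⁻¹, X * P * (1 - (X * P) ^ 3)⁻¹]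

/-- Generating function of `N ↦ (solutions (N + 1) s).ncard`. -/
noncomputable def series (P : ℚ⟦X⟧) : NormalForm → ℚ⟦X⟧
  | base c => baseSeries P (c + 1)
  | up c r => upSeries P (c + 1) * series P r

lemma one_sub_mul_inv (P : ℚ⟦X⟧) : (1 - (X * P) ^ 3) * (1 - (X * P) ^ 3)⁻¹ = 1 :=
  PowerSeries.mul_inv_cancel _ (by simp)

lemma baseSeries_eq (P : ℚ⟦X⟧) (c : Fin 3) :
    baseSeries P c = (if c = 0 then 1 else 0) + X * P * baseSeries P (c + 1) := by
  have h := one_sub_mul_inv P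
  fin_cases c
  · simp [baseSeries]; linear_combination h
  · simp [baseSeries]; ring
  · simp [baseSeries]

section
variable {P : ℚ⟦X⟧} (hP : (P - 1) * (1 - X ^ 3 * P ^ 2) = X * P ^ 2)
include hP

lemma upSeries_eq (c : Fin 3) (hc : c ≠ 0) :
    upSeries P c = X * P * upSeries P (c + 1) := by
  fin_cases c
  · exact absurd rfl hc
  · simp [upSeries]; linear_combination X * hP
  · simp [upSeries]

lemma series_eq (s : NormalForm) :
    series P s = (if rot s = base 0 then 1 else 0) + X * series P (rot s)
      + series P (flip (rot s)) := by
  have h1 : upSeries P (0 + 1) = X * (P - 1) := rfl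
  cases s with
  | base c =>
    simp only [series, rot, flip, h1, base.injEq]
    rw [baseSeries_eq P (c + 1)]
    ring
  | up c r =>
    by_cases hc : c + 1 = 0
    · simp only [series, rot, flip, hc, if_true, h1, reduceCtorEq, if_false]
      simp [upSeries]; ring
    · simp only [series, rot, flip, hc, h1, reduceCtorEq, if_false]
      rw [upSeries_eq hP (c + 1) hc]; ring

/-- A lower bound for the order of vanishing of the generating functions. -/
def orderBound : NormalForm → ℕ
  | base c => (![0, 2, 1] : Fin 3 → ℕ) (c + 1)
  | up c r => (![0, 2, 1] : Fin 3 → ℕ) (c + 1) + orderBound r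

lemma X_pow_dvd_series (s : NormalForm) : X ^ orderBound s ∣ series P s := by
  induction s with
  | base c =>
    simp only [orderBound, series]
    generalize c + 1 = d
    fin_cases d
    · simp
    · simp [baseSeries, mul_pow, mul_assoc]
    · simp [baseSeries, mul_assoc]
  | up c r ih =>
    simp only [orderBound, series, pow_add]
    refine mul_dvd_mul ?_ ih
    have h2 := upSeries_eq hP 2 (by decide)
    have h1 := upSeries_eq hP 1 (by decide)
    rw [show (1 + 1 : Fin 3) = 2 from rfl, h2] at h1
    generalize c + 1 = d
    fin_cases d
    · simp
    · exact ⟨P * (P * upSeries P (2 + 1)), by change upSeries P 1 = X ^ 2 * _; rw [h1]; ring⟩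
    · exact ⟨P * upSeries P (2 + 1), by change upSeries P 2 = X ^ 1 * _; rw [h2]; ring⟩

omit hP in
lemma potential_le_orderBound (s : NormalForm) :
    potential (rot s) ≤ 3 * orderBound s := by
  induction s with
  | base c => revert c; decide
  | up c r ih =>
    have h := potential_le_rot r
    have h' : ∀ d : Fin 3, weight d - 1 ≤ 3 * ((![0, 2, 1] : Fin 3 → ℕ) d : ℤ) := by decide
    have := h' (c + 1)
    simp only [rot, potential, orderBound]
    push_cast; omega

lemma coeff_series_eq_zero {N : ℕ} {s : NormalForm} (h : 3 * (N : ℤ) < potential (rot s)) :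
    coeff N (series P s) = 0 := by
  have := potential_le_orderBound s
  exact X_pow_dvd_iff.1 (X_pow_dvd_series hP s) N (by omega)

omit hP in
lemma solutions_zero (s : NormalForm) :
    solutions 0 s = if s = base 0 then {[]} else ∅ := by
  ext l
  split_ifs with h <;> simp +contextual [solutions, run, h]

lemma finite_solutions_and_ncard (n : ℕ) : ∀ (N : ℕ) (s : NormalForm),
    3 * (N : ℤ) - potential (rot s) < n →
      (solutions (N + 1) s).Finite ∧
        ((solutions (N + 1) s).ncard : ℚ) = coeff N (series P s) := by
  induction n with
  | zero =>
    intro N s h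
    have h' : 3 * (N : ℤ) < potential (rot s) := by push_cast at h; omega
    rw [solutions_eq_empty h', coeff_series_eq_zero hP h']
    simp
  | succ n ih =>
    intro N s h
    push_cast at h
    have hflip := potential_lt_rot_flip (rot s)
    obtain ⟨hf2, hc2⟩ := ih N (flip (rot s)) (by omega)
    have h1 : (solutions N (rot s)).Finite ∧ ((solutions N (rot s)).ncard : ℚ) =
        coeff N ((if rot s = base 0 then 1 else 0) + X * series P (rot s)) := by
      cases N with
      | zero => rw [solutions_zero]; split_ifs <;> simp
      | succ N =>
        have hrot := potential_le_rot (rot s)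
        obtain ⟨hf1, hc1⟩ := ih N (rot s) (by push_cast at h; omega)
        refine ⟨hf1, ?_⟩
        rw [hc1, map_add, coeff_succ_X_mul]
        split_ifs <;> simp [coeff_one]
    obtain ⟨hf1, hc1⟩ := h1
    have inj1 : Function.Injective (fun l : List ℕ => 0 :: l) := List.cons_injective
    have inj2 : Function.Injective (List.modifyHead (· + 1) : List ℕ → List ℕ) := by
      intro l l' hl
      cases l <;> cases l' <;> simp_all
    rw [solutions_succ]
    refine ⟨(hf1.image _).union (hf2.image _), ?_⟩
    rw [Set.ncard_union_eq ?_ (hf1.image _) (hf2.image _), Set.ncard_image_of_injective _ inj1,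
      Set.ncard_image_of_injective _ inj2, series_eq hP s, map_add, ← hc1, ← hc2]
    · push_cast; rfl
    · rw [Set.disjoint_left]
      rintro _ ⟨l, -, rfl⟩ ⟨l', -, hl'⟩
      cases l' <;> simp at hl'

lemma ncard_solutions (N : ℕ) (s : NormalForm) :
    ((solutions (N + 1) s).ncard : ℚ) = coeff N (series P s) :=
  (finite_solutions_and_ncard hP _ N s
    (Int.lt_of_lt_of_le (Int.lt_succ _) (Int.self_le_toNat _))).2

end

/-! ### Matrices -/

/-- The matrix represented by a normal form. -/
def toMatrix : NormalForm → Matrix (Fin 2) (Fin 2) ℤ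
  | base c => M 1 ^ (c : ℕ)
  | up c r => toMatrix r * M 0 * M 1 ^ (c : ℕ)

/-- Equality of matrices up to sign. -/
def EqUpToSign (A B : Matrix (Fin 2) (Fin 2) ℤ) : Prop := A = B ∨ A = -B

namespace EqUpToSign

variable {A B C : Matrix (Fin 2) (Fin 2) ℤ}

lemma trans (h : EqUpToSign A B) (h' : EqUpToSign B C) : EqUpToSign A C := by
  rcases h with rfl | rfl <;> rcases h' with rfl | rfl <;> simp [EqUpToSign]

lemma symm (h : EqUpToSign A B) : EqUpToSign B A := by
  rcases h with rfl | rfl <;> simp [EqUpToSign]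

lemma mul_right (h : EqUpToSign A B) (C : Matrix (Fin 2) (Fin 2) ℤ) :
    EqUpToSign (A * C) (B * C) := by
  rcases h with rfl | rfl <;> simp [EqUpToSign]

lemma mul_left (h : EqUpToSign A B) (C : Matrix (Fin 2) (Fin 2) ℤ) :
    EqUpToSign (C * A) (C * B) := by
  rcases h with rfl | rfl <;> simp [EqUpToSign]

end EqUpToSign

lemma M_one_pow_add_one (c : Fin 3) :
    EqUpToSign (M 1 ^ ((c + 1 : Fin 3) : ℕ)) (M 1 ^ (c : ℕ) * M 1) := by
  unfold EqUpToSign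
  revert c
  decide

lemma toMatrix_rot (s : NormalForm) : EqUpToSign (toMatrix (rot s)) (toMatrix s * M 1) := by
  cases s with
  | base c => exact M_one_pow_add_one c
  | up c r =>
    simp only [rot, toMatrix]
    rw [mul_assoc (toMatrix r * M 0)]
    exact (M_one_pow_add_one c).mul_left _

lemma M_zero_mul_self : M 0 * M 0 = -1 := by decide

lemma toMatrix_flip (s : NormalForm) : EqUpToSign (toMatrix (flip s)) (toMatrix s * M 0) := by
  cases s with
  | base c => simp [flip, toMatrix, EqUpToSign]
  | up c r =>
    by_cases hc : c = 0
    · subst hc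
      simp [flip, toMatrix, EqUpToSign, mul_assoc, M_zero_mul_self]
    · simp [flip, hc, toMatrix, EqUpToSign]

lemma M_add_one (a : ℤ) : M (a + 1) = -(M 1 * (M 0 * M a)) := by
  ext i j
  fin_cases i <;> fin_cases j <;> simp [M, add_comm]

lemma toMatrix_act (b : ℕ) : ∀ s : NormalForm,
    EqUpToSign (toMatrix (act s b)) (toMatrix s * M (b + 1)) := by
  induction b with
  | zero => intro s; simpa [act] using toMatrix_rot s
  | succ b ih =>
    intro s
    refine (ih _).trans ((((toMatrix_flip _).trans ((toMatrix_rot s).mul_right _)).mul_right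
      _).trans (Or.inr ?_))
    rw [Nat.cast_succ, M_add_one (b + 1)]
    simp [mul_assoc]

lemma toMatrix_run (l : List ℕ) : ∀ s : NormalForm,
    EqUpToSign (toMatrix (run s l)) (toMatrix s * (l.map fun b : ℕ => M (b + 1)).prod) := by
  induction l with
  | nil => intro s; simp [run, EqUpToSign]
  | cons b l ih =>
    intro s
    refine (ih (act s b)).trans (((toMatrix_act b s).mul_right _).trans (Or.inl ?_))
    simp [mul_assoc]

/-- All exponents above the base level are nonzero. -/
def Full : NormalForm → Prop
  | base _ => True
  | up c r => c ≠ 0 ∧ Full r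

/-- All exponents strictly between the base level and the top level are nonzero. -/
def Reduced : NormalForm → Prop
  | base _ => True
  | up _ r => Full r

lemma Full.reduced {s : NormalForm} (h : Full s) : Reduced s := by
  cases s with
  | base c => trivial
  | up c r => exact h.2

lemma Reduced.rot {s : NormalForm} (h : Reduced s) : Reduced (rot s) := by
  cases s <;> exact h

lemma Reduced.flip {s : NormalForm} (h : Reduced s) : Reduced (flip s) := by
  cases s with
  | base c => trivial
  | up c r =>
    by_cases hc : c = 0
    · simpa [NormalForm.flip, hc] using Full.reduced h
    · simp only [NormalForm.flip, if_neg hc]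
      exact ⟨hc, h⟩

lemma Reduced.act (b : ℕ) : ∀ {s : NormalForm}, Reduced s → Reduced (act s b) := by
  induction b with
  | zero => exact fun h => h.rot
  | succ b ih => exact fun h => ih h.rot.flip

lemma Reduced.run (l : List ℕ) : ∀ {s : NormalForm}, Reduced s → Reduced (run s l) := by
  induction l with
  | nil => exact fun h => h
  | cons b l ih => exact fun h => ih (h.act b)

lemma Full.exists_nonneg {s : NormalForm} (h : Full s) :
    ∃ (c : Fin 3) (p q r t : ℤ), 0 < p ∧ 0 ≤ q ∧ 0 ≤ r ∧ 0 < t ∧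
      EqUpToSign (toMatrix s * M 0) (M 1 ^ (c : ℕ) * M 0 * !![p, q; r, t]) := by
  induction s with
  | base c =>
    refine ⟨c, 1, 0, 0, 1, by simp, by simp, by simp, by simp, Or.inl ?_⟩
    rw [← Matrix.one_fin_two, mul_one]
    rfl
  | up c s ih =>
    obtain ⟨hc, hs⟩ := h
    obtain ⟨d, p, q, r, t, hp, hq, hr, ht, e⟩ := ih hs
    have e' := (e.mul_right (M 1 ^ (c : ℕ))).mul_right (M 0)
    fin_cases c
    · exact absurd rfl hc
    · refine ⟨d, p, p + q, r, r + t, hp, by omega, hr, by omega, e'.trans (Or.inr ?_)⟩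
      rw [mul_assoc, mul_assoc, mul_assoc, ← mul_neg]
      rw [← mul_assoc (M 1 ^ (d : ℕ))]
      congr 1
      ext i j
      fin_cases i <;> fin_cases j <;> simp [M, Matrix.mul_apply, Fin.sum_univ_two] <;> ring
    · refine ⟨d, p + q, q, r + t, t, by omega, hq, by omega, ht, e'.trans (Or.inr ?_)⟩
      rw [mul_assoc, mul_assoc, mul_assoc, ← mul_neg]
      rw [← mul_assoc (M 1 ^ (d : ℕ))]
      congr 1
      ext i j
      fin_cases i <;> fin_cases j <;> simp [M, pow_two, Matrix.mul_apply, Fin.sum_univ_two] <;> ring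

lemma Reduced.eq_base_zero {s : NormalForm} (h : Reduced s) (e : EqUpToSign (toMatrix s) 1) :
    s = base 0 := by
  cases s with
  | base c =>
    have : ∀ c : Fin 3, M 1 ^ (c : ℕ) = 1 ∨ M 1 ^ (c : ℕ) = -1 → c = 0 := by decide
    rw [this c e]
  | up c s =>
    exfalso
    obtain ⟨d, p, q, r, t, hp, hq, hr, ht, e'⟩ := Full.exists_nonneg h
    have e2 := (e'.mul_right (M 1 ^ (c : ℕ))).symm.trans e
    rcases e2 with e2 | e2 <;>
    · have h00 := congrFun (congrFun e2 0) 0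
      have h01 := congrFun (congrFun e2 0) 1
      have h10 := congrFun (congrFun e2 1) 0
      have h11 := congrFun (congrFun e2 1) 1
      clear e2 e' e h
      fin_cases c <;> fin_cases d <;>
        simp [M, pow_two, Matrix.mul_apply, Fin.sum_univ_two] at h00 h01 h10 h11 <;> omega

lemma run_eq_base_zero_iff (l : List ℕ) :
    run (base 0) l = base 0 ↔
      (l.map fun b : ℕ => M (b + 1)).prod = 1 ∨ (l.map fun b : ℕ => M (b + 1)).prod = -1 := by
  have h := toMatrix_run l (base 0)
  have h1 : toMatrix (base 0) = 1 := rfl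
  rw [h1, one_mul] at h
  constructor
  · intro hl
    rw [hl, h1] at h
    exact h.symm
  · intro hl
    exact Reduced.eq_base_zero (Reduced.run l (s := base 0) trivial) (h.trans hl)

lemma Qn_eq_ncard_solutions {n : ℕ} (hn : n ≠ 0) :
    Qn n = (solutions (n + 2) (base 0)).ncard := by
  rw [Qn, if_neg hn]
  refine Set.ncard_congr (fun a _ => List.ofFn fun i => (a i - 1).toNat) ?_ ?_ ?_
  · rintro a ⟨hpos, ha⟩
    refine ⟨by simp, (run_eq_base_zero_iff _).2 ?_⟩
    have : ((List.ofFn fun i => (a i - 1).toNat).map fun b : ℕ => M (b + 1))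
        = List.ofFn fun i => M (a i) := by
      rw [List.map_ofFn]
      congr 1
      funext i
      have := hpos i
      simp only [Function.comp]
      congr 1
      omega
    rwa [this]
  · rintro a b ⟨ha, -⟩ ⟨hb, -⟩ h
    funext i
    have h' := congrFun (List.ofFn_injective h) i
    have := ha i
    have := hb i
    omega
  · rintro l ⟨hl, hr⟩
    refine ⟨fun i => (l.get (i.cast hl.symm) : ℤ) + 1, ⟨fun i => by positivity, ?_⟩, ?_⟩
    · rw [run_eq_base_zero_iff] at hr
      convert hr using 3 <;>
      · apply List.ext_get <;> simp +contextual [hl, -List.ofFn_succ]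
    · apply List.ext_get <;> simp +contextual [hl, -List.ofFn_succ]

end NormalForm

open NormalForm in
theorem stmt4 (P : PowerSeries ℚ)
    (hP : (P - 1) * (1 - PowerSeries.X ^ 3 * P ^ 2) = PowerSeries.X * P ^ 2) :
    ((PowerSeries.mk fun n => (Qn n : ℚ)) - 1) * (1 - PowerSeries.X ^ 3 * P ^ 3)
      = PowerSeries.X * P ^ 2 := by
  have key : PowerSeries.X * ((PowerSeries.mk fun n => (Qn n : ℚ)) - 1)
      = series P (base 0) := by
    have hdvd := PowerSeries.X_pow_dvd_iff.1 (X_pow_dvd_series hP (base 0))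
    have hord : orderBound (base 0) = 2 := rfl
    ext n
    match n with
    | 0 => rw [hdvd 0 (by omega)]; simp
    | 1 =>
      rw [hdvd 1 (by omega), PowerSeries.coeff_succ_X_mul]
      simp [Qn]
    | n + 2 =>
      rw [PowerSeries.coeff_succ_X_mul, ← ncard_solutions hP,
        ← Qn_eq_ncard_solutions (Nat.succ_ne_zero n)]
      simp [PowerSeries.coeff_one]
  have hser : series P (base 0)
      = (PowerSeries.X * P) ^ 2 * (1 - (PowerSeries.X * P) ^ 3)⁻¹ := rfl
  rw [hser] at key
  refine mul_left_cancel₀ PowerSeries.X_ne_zero ?_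
  linear_combination (1 - (PowerSeries.X * P) ^ 3) * key
    + (PowerSeries.X * P) ^ 2 * one_sub_mul_inv P
end

section
/- Let N ≥ 4. The number of functions a : ℤ/Nℤ → ℤ satisfying all of: (1) M(a_0)·M(a_1)···M(a_{N−1}) = Id; (2) Σ_{i} a_i = 3N − 12; (3) there exists k ∈ ℤ/Nℤ with a_k = −1, a_{k−1} ≥ 0, a_{k+1} ≥ 0, and a_i ≥ 1 for every i ∉ {k−1, k, k+1}; is exactly N·C_{N−3}, where C_n denotes the n-th Catalan number. -/
namespace Quiddity

theorem prod_three (x y : ℤ) : M x * M 1 * M y = M (x - 1) * M (y - 1) := by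
  ext i j; fin_cases i <;> fin_cases j <;> simp [M, Matrix.mul_apply, Fin.sum_univ_two] <;> ring

theorem prod_neg_one (x y : ℤ) : M x * M (-1) * M y = -(M (x + 1) * M (y + 1)) := by
  ext i j; fin_cases i <;> fin_cases j <;> simp [M, Matrix.mul_apply, Fin.sum_univ_two] <;> ring

theorem prod_one_one (x y : ℤ) : M x * M 1 * M 1 * M y = -M (x + y - 1) := by
  ext i j; fin_cases i <;> fin_cases j <;> simp [M, Matrix.mul_apply, Fin.sum_univ_two]; ring

/-- The product of the matrices `M a` over the entries of a list. -/
def mprod (L : List ℤ) : Matrix (Fin 2) (Fin 2) ℤ := (L.map M).prod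

@[simp] theorem mprod_nil : mprod [] = 1 := rfl

@[simp] theorem mprod_cons (a : ℤ) (L : List ℤ) : mprod (a :: L) = M a * mprod L := by
  simp [mprod]

@[simp] theorem mprod_append (L L' : List ℤ) : mprod (L ++ L') = mprod L * mprod L' := by
  simp [mprod]

theorem mul_comm_of_sq_one {A B ε : Matrix (Fin 2) (Fin 2) ℤ} (hε : ε = 1 ∨ ε = -1)
    (h : A * B = ε) : B * A = ε := by
  rcases hε with rfl | rfl
  · exact mul_eq_one_comm.1 h
  · have : (-A) * B = 1 := by rw [neg_mul, h, neg_neg]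
    have := mul_eq_one_comm.1 this
    rw [mul_neg] at this
    rw [← this, neg_neg]

theorem mprod_entries_of_two_le (c : List ℤ) (hc : ∀ x ∈ c, 2 ≤ x) :
    0 ≤ mprod c 1 0 ∧ mprod c 1 0 + 1 ≤ mprod c 0 0 := by
  induction c with
  | nil => simp
  | cons a c ih =>
    obtain ⟨h1, h2⟩ := ih fun x hx => hc x (by simp [hx])
    have ha := hc a (by simp)
    simp only [mprod_cons, M, Matrix.mul_apply, Fin.sum_univ_two]
    simp
    constructor <;> nlinarith

/-- A nonempty list of positive integers whose matrix product is `±1` has an interior entry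
equal to `1`. -/
theorem exists_interior_one {L : List ℤ} (hL : L ≠ []) (hpos : ∀ x ∈ L, 1 ≤ x)
    (h : mprod L = 1 ∨ mprod L = -1) :
    ∃ l₁ x y l₂, L = l₁ ++ x :: 1 :: y :: l₂ := by
  obtain ⟨a, L, rfl⟩ := List.exists_cons_of_ne_nil hL
  rcases List.eq_nil_or_concat L with rfl | ⟨c, b, rfl⟩
  · exfalso
    rcases h with h | h <;> simpa [M] using congrFun (congrFun h 1) 0
  by_cases hc : ∀ x ∈ c, 2 ≤ x
  · exfalso
    have key : mprod (a :: (c ++ [b])) 1 1 = -mprod c 0 0 := by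
      simp [M, Matrix.mul_apply, Fin.sum_univ_two]
    rcases c with _ | ⟨d, c⟩
    · have hb := hpos b (by simp)
      have key : mprod (a :: ([] ++ [b])) 1 0 = b := by
        simp [M, Matrix.mul_apply, Fin.sum_univ_two]
      rw [← key] at hb
      rcases h with h | h <;> rw [List.concat_eq_append] at h <;> rw [h] at hb <;> simp at hb
    · have h1 := mprod_entries_of_two_le (d :: c) hc
      have h2 := mprod_entries_of_two_le c fun x hx => hc x (by simp [hx])
      have h3 : mprod (d :: c) 1 0 = mprod c 0 0 := by
        simp [M, Matrix.mul_apply, Fin.sum_univ_two]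
      rcases h with h | h <;> rw [List.concat_eq_append] at h <;> rw [h] at key <;>
        simp at key <;> simp at h1 h3 <;> omega
  · push Not at hc
    obtain ⟨z, hz, hz2⟩ := hc
    have hz1 : z = 1 := le_antisymm (by omega) (hpos z (by simp [hz]))
    subst hz1
    obtain ⟨s, t, rfl⟩ := List.append_of_mem hz
    obtain ⟨l₁, x, hx⟩ : ∃ l₁ x, a :: s = l₁ ++ [x] := by
      rcases List.eq_nil_or_concat (a :: s) with h | ⟨l, x, h⟩
      · simp at h
      · exact ⟨l, x, by simpa using h⟩
    obtain ⟨y, l₂, hy⟩ := List.exists_cons_of_ne_nil (show t ++ [b] ≠ [] by simp)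
    refine ⟨l₁, x, y, l₂, ?_⟩
    rw [← hy, List.concat_eq_append]
    have : l₁ ++ x :: 1 :: (t ++ [b]) = (l₁ ++ [x]) ++ 1 :: (t ++ [b]) := by simp
    rw [this, ← hx]
    simp

/-- A bound on the sum for adjacent ones, given the general bound for shorter lists. -/
theorem sum_le_of_adjacent_ones {l₁ l₂ : List ℤ}
    (ih : ∀ L : List ℤ, L.length < (l₁ ++ 1 :: 1 :: l₂).length → L ≠ [] → (∀ x ∈ L, 1 ≤ x) →
      (mprod L = 1 ∨ mprod L = -1) → L.sum + 6 ≤ 3 * L.length)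
    (hlen : 4 ≤ (l₁ ++ 1 :: 1 :: l₂).length) (hpos : ∀ x ∈ l₁ ++ 1 :: 1 :: l₂, 1 ≤ x)
    (h : mprod (l₁ ++ 1 :: 1 :: l₂) = 1 ∨ mprod (l₁ ++ 1 :: 1 :: l₂) = -1) :
    (l₁ ++ 1 :: 1 :: l₂).sum + 12 ≤ 3 * (l₁ ++ 1 :: 1 :: l₂).length := by
  obtain ⟨z, R, hR⟩ := List.exists_cons_of_ne_nil (show l₂ ++ l₁ ≠ [] by
    rintro h; simp at h; simp [h] at hlen)
  have hlenR : l₂.length + l₁.length = R.length + 1 := by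
    simpa using congrArg List.length hR
  have hsumR : l₂.sum + l₁.sum = z + R.sum := by simpa using congrArg List.sum hR
  have hposR : ∀ x ∈ z :: R, 1 ≤ x := by
    rw [← hR]; intro x hx; apply hpos; simp at hx ⊢; tauto
  simp only [List.length_append, List.length_cons] at hlen ih
  obtain ⟨mid, w, hmid⟩ : ∃ l x, R = l ++ [x] := by
    rcases List.eq_nil_or_concat R with h | ⟨l, x, h⟩
    · simp [h] at hlenR; omega
    · exact ⟨l, x, by simpa using h⟩
  subst hmid
  simp only [List.length_append, List.length_cons, List.length_nil, List.sum_append,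
    List.sum_cons, List.sum_nil] at hlenR hsumR
  have hz := hposR z (by simp)
  have hw := hposR w (by simp)
  have key : ∀ ε : Matrix (Fin 2) (Fin 2) ℤ, (ε = 1 ∨ ε = -1) →
      mprod (l₁ ++ 1 :: 1 :: l₂) = ε → mprod ((w + z - 1) :: mid) = -ε := by
    intro ε hε h
    have h1 : (M 1 * (M 1 * mprod (l₂ ++ l₁))) = ε := by
      have := mul_comm_of_sq_one hε (A := mprod l₁) (B := M 1 * (M 1 * mprod l₂)) (by simpa using h)
      rw [← this]; simp [mul_assoc]
    rw [hR] at h1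
    have h2 := mul_comm_of_sq_one hε (A := M 1 * M 1 * M z * mprod mid) (B := M w)
      (by rw [← h1]; simp [mul_assoc])
    rw [← h2, mprod_cons, ← neg_neg (M (w + z - 1)), ← prod_one_one]
    simp [mul_assoc]
  have := ih ((w + z - 1) :: mid) (by simp; omega) (by simp)
    (by
      intro x hx
      rcases List.mem_cons.1 hx with rfl | hx
      · omega
      · exact hposR x (by simp [hx]))
    (by
      rcases h with h | h
      · right; exact key 1 (by simp) h
      · left; simpa using key (-1) (by simp) h)
  simp at this ⊢
  omega

theorem mprod_ear (l₁ l₂ : List ℤ) (x y : ℤ) :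
    mprod (l₁ ++ x :: 1 :: y :: l₂) = mprod (l₁ ++ (x - 1) :: (y - 1) :: l₂) := by
  simp only [mprod_append, mprod_cons]
  rw [← mul_assoc (M x), ← mul_assoc (M x * M 1), prod_three]
  simp [mul_assoc]

theorem sum_le (L : List ℤ) (hL : L ≠ []) (hpos : ∀ x ∈ L, 1 ≤ x)
    (h : mprod L = 1 ∨ mprod L = -1) : L.sum + 6 ≤ 3 * L.length := by
  induction hn : L.length using Nat.strong_induction_on generalizing L with
  | _ n ih =>
  subst hn
  obtain ⟨l₁, x, y, l₂, rfl⟩ := exists_interior_one hL hpos h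
  have hx := hpos x (by simp)
  have hy := hpos y (by simp)
  have ih' : ∀ L' : List ℤ, L'.length < (l₁ ++ x :: 1 :: y :: l₂).length → L' ≠ [] →
      (∀ x ∈ L', 1 ≤ x) → (mprod L' = 1 ∨ mprod L' = -1) → L'.sum + 6 ≤ 3 * L'.length :=
    fun L' h1 h2 h3 h4 => ih _ h1 L' h2 h3 h4 rfl
  by_cases hlen : 4 ≤ (l₁ ++ x :: 1 :: y :: l₂).length
  · by_cases hx1 : x = 1
    · subst hx1
      have := sum_le_of_adjacent_ones ih' hlen hpos h
      omega
    by_cases hy1 : y = 1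
    · subst hy1
      have e : l₁ ++ x :: 1 :: 1 :: l₂ = (l₁ ++ [x]) ++ 1 :: 1 :: l₂ := by simp
      rw [e] at ih' hlen hpos h ⊢
      have := sum_le_of_adjacent_ones ih' hlen hpos h
      omega
    have := ih' (l₁ ++ (x - 1) :: (y - 1) :: l₂) (by simp) (by simp)
      (by
        intro z hz
        simp only [List.mem_append, List.mem_cons] at hz
        rcases hz with hz | rfl | rfl | hz
        · exact hpos z (by simp [hz])
        · omega
        · omega
        · exact hpos z (by simp [hz]))
      (by rwa [← mprod_ear])
    simp at this ⊢
    omega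
  · simp at hlen
    obtain rfl : l₁ = [] := List.length_eq_zero_iff.1 (by omega)
    obtain rfl : l₂ = [] := List.length_eq_zero_iff.1 (by omega)
    have key : mprod ([] ++ [x, 1, y]) 1 0 = y - 1 ∧ mprod ([] ++ [x, 1, y]) 0 1 = 1 - x := by
      simp [M, Matrix.mul_apply, Fin.sum_univ_two]
      constructor <;> ring
    rcases h with h | h <;> rw [h] at key <;> simp at key ⊢ <;> omega

/-- In a quiddity list of length at least four, an interior `1` has neighbours at least `2`. -/
theorem exists_ear {L : List ℤ} (hlen : 4 ≤ L.length) (hpos : ∀ x ∈ L, 1 ≤ x)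
    (h : mprod L = -1) (hsum : L.sum + 6 = 3 * L.length) :
    ∃ l₁ x y l₂, 2 ≤ x ∧ 2 ≤ y ∧ L = l₁ ++ x :: 1 :: y :: l₂ := by
  obtain ⟨l₁, x, y, l₂, rfl⟩ :=
    exists_interior_one (by rintro rfl; simp at hlen) hpos (Or.inr h)
  have hx := hpos x (by simp)
  have hy := hpos y (by simp)
  refine ⟨l₁, x, y, l₂, ?_, ?_, rfl⟩
  · by_contra hx1
    obtain rfl : x = 1 := by omega
    have := sum_le_of_adjacent_ones (fun L _ => sum_le L) hlen hpos (Or.inr h)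
    omega
  · by_contra hx1
    obtain rfl : y = 1 := by omega
    have e : l₁ ++ x :: 1 :: 1 :: l₂ = (l₁ ++ [x]) ++ 1 :: 1 :: l₂ := by simp
    rw [e] at hlen hpos h hsum
    have := sum_le_of_adjacent_ones (fun L _ => sum_le L) hlen hpos (Or.inr h)
    omega

open BinaryTree

/-- The entry of the quiddity list of a triangulation at its first vertex. -/
def fst : BinaryTree Unit → ℤ
  | nil => 0
  | node _ l _ => fst l + 1

/-- The entry of the quiddity list of a triangulation at its last vertex. -/
def lst : BinaryTree Unit → ℤ
  | nil => 0
  | node _ _ r => lst r + 1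

/-- The entries of the quiddity list of a triangulation at the remaining vertices. -/
def mid : BinaryTree Unit → List ℤ
  | nil => []
  | node _ l r => mid l ++ (lst l + (fst r + 1)) :: mid r

theorem fst_nonneg (t : BinaryTree Unit) : 0 ≤ fst t := by
  induction t with
  | nil => simp [fst]
  | node _ l r hl hr => simp only [fst]; omega

theorem lst_nonneg (t : BinaryTree Unit) : 0 ≤ lst t := by
  induction t with
  | nil => simp [lst]
  | node _ l r hl hr => simp only [lst]; omega

theorem one_le_fst {t : BinaryTree Unit} (h : t.numNodes ≠ 0) : 1 ≤ fst t := by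
  cases t with
  | nil => simp at h
  | node _ l r => have := fst_nonneg l; simp only [fst]; omega

theorem one_le_lst {t : BinaryTree Unit} (h : t.numNodes ≠ 0) : 1 ≤ lst t := by
  cases t with
  | nil => simp at h
  | node _ l r => have := lst_nonneg r; simp only [lst]; omega

theorem one_le_of_mem_mid (t : BinaryTree Unit) : ∀ x ∈ mid t, 1 ≤ x := by
  induction t with
  | nil => simp [mid]
  | node _ l r hl hr =>
    intro x hx
    simp only [mid, List.mem_append, List.mem_cons] at hx
    have := lst_nonneg l
    have := fst_nonneg r
    rcases hx with hx | rfl | hx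
    · exact hl x hx
    · omega
    · exact hr x hx

theorem length_mid (t : BinaryTree Unit) : (mid t).length = t.numNodes := by
  induction t with
  | nil => simp [mid]
  | node _ l r hl hr => simp [mid, hl, hr]; omega

theorem sum_quiddity (t : BinaryTree Unit) : fst t + (mid t).sum + lst t = 3 * t.numNodes := by
  induction t with
  | nil => simp [fst, mid, lst]
  | node _ l r hl hr => simp [fst, mid, lst]; omega

theorem mprod_quiddity (t : BinaryTree Unit) (a b : ℤ) :
    M (fst t + a) * mprod (mid t) * M (lst t + b) = M a * M b := by
  induction t generalizing a b with
  | nil => simp [fst, mid, lst]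
  | node _ l r hl hr =>
    have h1 := hl (1 + a) (fst r + 1)
    have h2 := hr 1 (1 + b)
    simp only [fst, mid, lst, mprod_append, mprod_cons, add_assoc]
    calc _ = M (fst l + (1 + a)) * mprod (mid l) * M (lst l + (fst r + 1)) *
          (mprod (mid r) * M (lst r + (1 + b))) := by simp only [mul_assoc]
      _ = M (1 + a) * (M (fst r + 1) * mprod (mid r) * M (lst r + (1 + b))) := by
          rw [h1]; simp only [mul_assoc]
      _ = M a * M b := by
          rw [h2, ← mul_assoc, prod_three]; simp

/-- The labels `v_{i+1} = a_i v_i - v_{i-1}` generated by a list, starting from `p, c`. -/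
def labels : ℤ → ℤ → List ℤ → List ℤ
  | _, _, [] => []
  | p, c, a :: L => c :: labels c (a * c - p) L

/-- The Stern–Brocot labels of the nodes of a tree, in order, with boundary labels `u, w`. -/
def sternBrocot : BinaryTree Unit → ℤ → ℤ → List ℤ
  | nil, _, _ => []
  | node _ l r, u, w => sternBrocot l u (u + w) ++ (u + w) :: sternBrocot r (u + w) w

theorem labels_quiddity (t : BinaryTree Unit) (u w b : ℤ) (L : List ℤ) :
    labels u (fst t * u + w) (mid t ++ (lst t + b) :: L) =
      sternBrocot t u w ++ w :: labels w (b * w - u) L := by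
  induction t generalizing u w b L with
  | nil => simp [fst, mid, lst, labels, sternBrocot]
  | node _ l r hl hr =>
    have h1 := hl u (u + w) (fst r + 1) (mid r ++ (lst r + (1 + b)) :: L)
    have h2 := hr (u + w) w (1 + b) L
    simp only [fst, mid, lst, sternBrocot, List.append_assoc, List.cons_append, add_assoc]
    rw [show (fst l + 1) * u + w = fst l * u + (u + w) by ring, h1,
      show (fst r + 1) * (u + w) - u = fst r * (u + w) + w by ring, h2,
      show (1 + b) * w - (u + w) = b * w - u by ring]

theorem le_of_mem_sternBrocot {t : BinaryTree Unit} {u w : ℤ} (hu : 0 ≤ u) (hw : 0 ≤ w) :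
    ∀ x ∈ sternBrocot t u w, u + w ≤ x := by
  induction t generalizing u w with
  | nil => simp [sternBrocot]
  | node _ l r hl hr =>
    intro x hx
    simp only [sternBrocot, List.mem_append, List.mem_cons] at hx
    rcases hx with hx | rfl | hx
    · have := hl hu (by omega) x hx; omega
    · exact le_rfl
    · have := hr (by omega) hw x hx; omega

theorem sternBrocot_injective {t t' : BinaryTree Unit} {u w : ℤ} (hu : 0 < u) (hw : 0 < w)
    (h : sternBrocot t u w = sternBrocot t' u w) : t = t' := by
  induction t generalizing t' u w with
  | nil => cases t' with
    | nil => rfl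
    | node _ l r => simp [sternBrocot] at h
  | node _ l r hl hr => cases t' with
    | nil => simp [sternBrocot] at h
    | node _ l' r' =>
      simp only [sternBrocot] at h
      rw [List.append_cons_inj_of_notMem] at h
      · rw [hl hu (by omega) h.1, hr (by omega) hw h.2.2]
      · intro hx
        have := le_of_mem_sternBrocot hu.le (by omega) _ hx
        omega
      · intro hx
        have := le_of_mem_sternBrocot (by omega) hw.le _ hx
        omega

theorem quiddity_injective {t t' : BinaryTree Unit} (h1 : fst t = fst t') (h2 : mid t = mid t')
    (h3 : lst t = lst t') : t = t' := by
  have h := labels_quiddity t 1 1 0 []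
  have h' := labels_quiddity t' 1 1 0 []
  rw [h1, h2, h3, h'] at h
  exact sternBrocot_injective one_pos one_pos (List.append_cancel_right h).symm

/-- Gluing a triangle to an edge of a triangulation, other than the root edge. -/
theorem exists_insert_ear (t : BinaryTree Unit) (a b : ℤ) (l₁ l₂ : List ℤ) (x y : ℤ)
    (h : (fst t + a) :: (mid t ++ [lst t + b]) = l₁ ++ x :: y :: l₂) :
    ∃ t' : BinaryTree Unit, t'.numNodes = t.numNodes + 1 ∧
      (fst t' + a) :: (mid t' ++ [lst t' + b]) = l₁ ++ (x + 1) :: 1 :: (y + 1) :: l₂ := by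
  induction t generalizing a b l₁ l₂ x y with
  | nil =>
    refine ⟨node () nil nil, by simp, ?_⟩
    have hlen := congrArg List.length h
    simp [mid] at hlen
    obtain rfl : l₁ = [] := List.length_eq_zero_iff.1 (by omega)
    obtain rfl : l₂ = [] := List.length_eq_zero_iff.1 (by omega)
    simp [fst, mid, lst] at h ⊢
    omega
  | node _ l r hl hr =>
    have left : ∀ l₂', (fst l + (1 + a)) :: (mid l ++ [lst l + (fst r + 1)]) =
        l₁ ++ x :: y :: l₂' → l₂ = l₂' ++ (mid r ++ [lst r + (1 + b)]) →
        ∃ t' : BinaryTree Unit, t'.numNodes = (node () l r).numNodes + 1 ∧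
        (fst t' + a) :: (mid t' ++ [lst t' + b]) = l₁ ++ (x + 1) :: 1 :: (y + 1) :: l₂ := by
      rintro l₂' h₀ rfl
      obtain ⟨l', hn, hl'⟩ := hl _ _ _ _ _ _ h₀
      refine ⟨node () l' r, by simp [hn]; omega, ?_⟩
      have := congrArg (· ++ (mid r ++ [lst r + (1 + b)])) hl'
      simpa [fst, mid, lst, add_assoc] using this
    have right : ∀ l₁', (lst l + (fst r + 1)) :: (mid r ++ [lst r + (1 + b)]) =
        l₁' ++ x :: y :: l₂ → l₁ = (fst l + (1 + a)) :: mid l ++ l₁' →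
        ∃ t' : BinaryTree Unit, t'.numNodes = (node () l r).numNodes + 1 ∧
        (fst t' + a) :: (mid t' ++ [lst t' + b]) = l₁ ++ (x + 1) :: 1 :: (y + 1) :: l₂ := by
      rintro l₁' h₀ rfl
      obtain ⟨r', hn, hr'⟩ := hr (lst l + 1) (1 + b) _ _ _ _
        (by rw [← h₀, add_left_comm (fst r)])
      refine ⟨node () l r', by simp [hn]; omega, ?_⟩
      simp only [fst, mid, lst, List.append_assoc, List.cons_append, add_assoc] at hr' ⊢
      rw [← hr', add_left_comm (fst r'), add_comm 1 a]
    have h' : ((fst l + (1 + a)) :: mid l) ++ (lst l + (fst r + 1)) ::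
        (mid r ++ [lst r + (1 + b)]) = l₁ ++ x :: y :: l₂ := by
      rw [← h]; simp [fst, mid, lst, add_assoc]
    rcases List.append_eq_append_iff.1 h' with ⟨as, h1, h2⟩ | ⟨bs, h1, h2⟩
    · exact right as h2 h1
    · rcases bs with _ | ⟨x', _ | ⟨y', bs⟩⟩
      · exact right [] (by simpa using h2.symm) (by simpa using h1.symm)
      · simp only [List.cons_append, List.nil_append, List.cons.injEq] at h2
        obtain ⟨rfl, rfl, rfl⟩ := h2
        exact left [] (by simpa using congrArg (· ++ [lst l + (fst r + 1)]) h1) (by simp)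
      · simp only [List.cons_append, List.cons.injEq] at h2
        obtain ⟨rfl, rfl, rfl⟩ := h2
        exact left (bs ++ [lst l + (fst r + 1)])
          (by simpa using congrArg (· ++ [lst l + (fst r + 1)]) h1) (by simp)

/-- The Conway–Coxeter theorem: lists of `n + 3` positive integers with matrix product `-1` and
sum `3 (n + 3) - 6` are quiddity lists of triangulations. -/
theorem exists_tree (n : ℕ) (L : List ℤ) (hlen : L.length = n + 3) (hpos : ∀ x ∈ L, 1 ≤ x)
    (h : mprod L = -1) (hsum : L.sum = 3 * (n + 1)) :
    ∃ t : BinaryTree Unit, t.numNodes = n + 1 ∧ fst t :: (mid t ++ [lst t]) = L := by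
  induction n generalizing L with
  | zero =>
    refine ⟨node () nil nil, by simp, ?_⟩
    obtain ⟨a, b, c, rfl⟩ := List.length_eq_three.1 hlen
    have h1 := hpos a (by simp)
    have h2 := hpos b (by simp)
    have h3 := hpos c (by simp)
    simp at hsum
    simp [fst, mid, lst]
    omega
  | succ n ih =>
    obtain ⟨l₁, x, y, l₂, hx, hy, rfl⟩ := exists_ear (by omega) hpos h
      (by rw [hsum, hlen]; push_cast; ring)
    obtain ⟨t, hn, ht⟩ := ih (l₁ ++ (x - 1) :: (y - 1) :: l₂) (by simp at hlen ⊢; omega)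
      (by
        intro z hz
        simp only [List.mem_append, List.mem_cons] at hz
        rcases hz with hz | rfl | rfl | hz
        · exact hpos z (by simp [hz])
        · omega
        · omega
        · exact hpos z (by simp [hz]))
      (by rwa [← mprod_ear])
      (by simp at hsum ⊢; linarith)
    obtain ⟨t', hn', ht'⟩ := exists_insert_ear t 0 0 _ _ _ _ (by simpa using ht)
    exact ⟨t', by omega, by simpa using ht'⟩

/-- The values of `a` read cyclically from `k`. -/
def window {N : ℕ} (a : ZMod N → ℤ) (k : ZMod N) : List ℤ :=
  (List.range N).map fun i => a (k + (i : ℕ))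

@[simp] theorem length_window {N : ℕ} (a : ZMod N → ℤ) (k : ZMod N) :
    (window a k).length = N := by simp [window]

theorem getElem_window {N : ℕ} (a : ZMod N → ℤ) (k : ZMod N) (i : ℕ)
    (hi : i < (window a k).length) : (window a k)[i] = a (k + (i : ℕ)) := by
  simp [window]

theorem mprod_window_add_one {N : ℕ} [NeZero N] (a : ZMod N → ℤ) (k : ZMod N)
    (h : mprod (window a k) = 1) : mprod (window a (k + 1)) = 1 := by
  obtain ⟨n, rfl⟩ := Nat.exists_eq_succ_of_ne_zero (NeZero.ne N)
  have h1 : window a k = a k :: (List.range n).map fun i => a (k + 1 + (i : ℕ)) := by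
    simp [window, List.range_succ_eq_map, add_left_comm, add_comm]
  have h2 : window a (k + 1) = ((List.range n).map fun i => a (k + 1 + (i : ℕ))) ++ [a k] := by
    have : k + 1 + (n : ZMod (n + 1)) = k := by
      have := ZMod.natCast_self (n + 1)
      push_cast at this
      rw [add_assoc, add_comm 1, this, add_zero]
    simp [window, List.range_succ, this]
  rw [h1, mprod_cons] at h
  rw [h2, mprod_append]
  simpa using mul_eq_one_comm.1 h

theorem mprod_window {N : ℕ} [NeZero N] (a : ZMod N → ℤ) (k m : ZMod N)
    (h : mprod (window a k) = 1) : mprod (window a m) = 1 := by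
  have key : ∀ j : ℕ, mprod (window a (k + j)) = 1 := by
    intro j
    induction j with
    | zero => simpa using h
    | succ j ih => simpa [add_assoc] using mprod_window_add_one a _ ih
  simpa using key (m - k).val

theorem sum_window {N : ℕ} [NeZero N] (a : ZMod N → ℤ) (k : ZMod N) :
    (window a k).sum = ∑ i, a i := by
  have h : (window a k).sum = ∑ i ∈ Finset.range N, a (k + (i : ℕ)) := rfl
  rw [h]
  refine Finset.sum_nbij' (fun i => k + (i : ℕ)) (fun j => (j - k).val) ?_ ?_ ?_ ?_ ?_
  · simp
  · intro j _; simpa using ZMod.val_lt _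
  · intro i hi; simpa using ZMod.val_cast_of_lt (Finset.mem_range.1 hi)
  · simp
  · simp

/-- The list `-1, a₀ - 1, a₁, …, aₙ - 1` for the quiddity list `a₀, …, aₙ` of `t`. -/
def blowup (t : BinaryTree Unit) : List ℤ := -1 :: (fst t - 1) :: (mid t ++ [lst t - 1])

theorem length_blowup (t : BinaryTree Unit) : (blowup t).length = t.numNodes + 3 := by
  simp [blowup, length_mid]

/-- The cyclic function reading the list `blowup t` from `k`. -/
def sol (N : ℕ) (k : ZMod N) (t : BinaryTree Unit) (j : ZMod N) : ℤ :=
  (blowup t).getD (j - k).val 0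

theorem window_sol {N : ℕ} [NeZero N] (k : ZMod N) {t : BinaryTree Unit}
    (h : t.numNodes + 3 = N) : window (sol N k t) k = blowup t := by
  apply List.ext_getElem
  · simp [length_blowup, h]
  · intro i h1 h2
    rw [getElem_window, sol, add_sub_cancel_left,
      ZMod.val_cast_of_lt (by simpa using h1), List.getD_eq_getElem _ _ h2]

theorem eq_sol {N : ℕ} [NeZero N] {a : ZMod N → ℤ} {k : ZMod N} {t : BinaryTree Unit}
    (h : window a k = blowup t) : a = sol N k t := by
  funext j
  have hj : (j - k).val < (window a k).length := by simpa using ZMod.val_lt _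
  rw [sol, ← h, List.getD_eq_getElem _ _ hj, getElem_window]
  simp

theorem mprod_blowup (t : BinaryTree Unit) : mprod (blowup t) = 1 := by
  have h := mprod_quiddity t 0 0
  have e : M (lst t - 1) * (M (-1) * (M (fst t - 1) * mprod (mid t))) = 1 := by
    rw [← mul_assoc (M (-1)), ← mul_assoc, ← mul_assoc (M (lst t - 1)), prod_neg_one]
    have h0 : M 0 * M 0 = -1 := by
      ext i j; fin_cases i <;> fin_cases j <;> simp [M, Matrix.mul_apply, Fin.sum_univ_two]
    have := mul_comm_of_sq_one (Or.inr rfl) (h.trans h0)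
    simp only [add_zero] at this
    simp [mul_assoc, this]
  rw [mul_eq_one_comm] at e
  simpa [blowup, mul_assoc] using e

theorem sum_blowup (t : BinaryTree Unit) : (blowup t).sum = 3 * t.numNodes - 3 := by
  have := sum_quiddity t
  simp [blowup]
  omega

section

variable {N : ℕ} {k : ZMod N} {t : BinaryTree Unit}

theorem sol_self : sol N k t k = -1 := by simp [sol, blowup]

theorem sol_eq_getElem (h : t.numNodes + 3 = N) (i : ℕ) (hi : i < (blowup t).length) :
    sol N k t (k + (i : ℕ)) = (blowup t)[i] := by
  rw [length_blowup, h] at hi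
  rw [sol, add_sub_cancel_left, ZMod.val_cast_of_lt hi, List.getD_eq_getElem]

theorem sol_add_one (h : t.numNodes + 3 = N) : sol N k t (k + 1) = fst t - 1 := by
  have := sol_eq_getElem (k := k) h 1 (by rw [length_blowup]; omega)
  simpa [blowup] using this

theorem sol_sub_one (h : t.numNodes + 3 = N) : sol N k t (k - 1) = lst t - 1 := by
  have := sol_eq_getElem (k := k) h (t.numNodes + 2) (by rw [length_blowup]; omega)
  have e : ((t.numNodes + 2 : ℕ) : ZMod N) = -1 := by
    rw [eq_neg_iff_add_eq_zero, ← ZMod.natCast_self N, ← h]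
    push_cast; ring
  rw [e, ← sub_eq_add_neg] at this
  rw [this]
  simp [blowup, ← length_mid]

theorem one_le_sol [NeZero N] (h : t.numNodes + 3 = N) {i : ZMod N}
    (hi : i ∉ ({k - 1, k, k + 1} : Set (ZMod N))) : 1 ≤ sol N k t i := by
  have hlt := ZMod.val_lt (i - k)
  have hik : i = k + ((i - k).val : ℕ) := by simp
  generalize (i - k).val = m at hlt hik
  subst hik
  simp only [Set.mem_insert_iff, Set.mem_singleton_iff, not_or] at hi
  rw [sol_eq_getElem h m (by rw [length_blowup]; omega)]
  rcases m with _ | _ | m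
  · simp at hi
  · simp at hi
  · have hm : m < (mid t).length := by
      rw [length_mid]
      by_contra hc
      apply hi.1
      have : m + 1 + 1 + 1 = N := by omega
      have : ((m + 1 + 1 + 1 : ℕ) : ZMod N) = 0 := by rw [this, ZMod.natCast_self]
      push_cast at this ⊢
      rw [sub_eq_add_neg, eq_neg_of_add_eq_zero_left this]
    have : (blowup t)[m + 1 + 1]'(by rw [length_blowup, ← length_mid]; omega) = (mid t)[m] := by
      simp [blowup, List.getElem_append_left hm]
    rw [this]
    exact one_le_of_mem_mid t _ (List.getElem_mem hm)

theorem sol_nonneg [NeZero N] (hN : 4 ≤ N) (h : t.numNodes + 3 = N) {i : ZMod N} (hi : i ≠ k) :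
    0 ≤ sol N k t i := by
  by_cases hi' : i ∈ ({k - 1, k, k + 1} : Set (ZMod N))
  · simp only [Set.mem_insert_iff, Set.mem_singleton_iff] at hi'
    rcases hi' with rfl | rfl | rfl
    · rw [sol_sub_one h]
      have := one_le_lst (t := t) (by omega)
      omega
    · exact absurd rfl hi
    · rw [sol_add_one h]
      have := one_le_fst (t := t) (by omega)
      omega
  · exact zero_le_one.trans (one_le_sol h hi')

end

theorem exists_blowup_eq_window {N : ℕ} [NeZero N] (hN : 4 ≤ N) {a : ZMod N → ℤ} {k : ZMod N}
    (hprod : mprod (window a k) = 1) (hsum : (window a k).sum = 3 * (N : ℤ) - 12)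
    (hk : a k = -1) (hl : 0 ≤ a (k - 1)) (hr : 0 ≤ a (k + 1))
    (hpos : ∀ i : ZMod N, i ∉ ({k - 1, k, k + 1} : Set (ZMod N)) → 1 ≤ a i) :
    ∃ t : BinaryTree Unit, t.numNodes + 3 = N ∧ window a k = blowup t := by
  obtain ⟨n, rfl⟩ : ∃ n, N = n + 4 := ⟨N - 4, by omega⟩
  set c := (List.range (n + 1)).map fun i => a (k + 2 + (i : ℕ)) with hc
  have hcast : (n : ZMod (n + 4)) = -4 := by
    have := ZMod.natCast_self (n + 4)
    push_cast at this
    exact eq_neg_of_add_eq_zero_left this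
  have hw : window a k = -1 :: a (k + 1) :: (c ++ [a (k - 1)]) := by
    apply List.ext_getElem
    · simp [hc]
    · intro i h1 h2
      rw [getElem_window]
      rcases i with _ | _ | i
      · simp [hk]
      · simp
      · simp at h1
        rcases (show i < n + 1 ∨ i = n + 1 by omega) with hi | rfl
        · simp [hc, List.getElem_append_left, hi]
          congr 1; ring
        · simp [hc, hcast]
          congr 1; ring
  have hcpos : ∀ x ∈ c, 1 ≤ x := by
    intro x hx
    obtain ⟨i, hi, rfl⟩ := List.mem_map.1 hx
    rw [List.mem_range] at hi
    apply hpos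
    have hne : ∀ m : ℕ, 0 < m → m < n + 4 → ((m : ℕ) : ZMod (n + 4)) ≠ 0 := by
      intro m h0 h1 h2
      rw [ZMod.natCast_eq_zero_iff] at h2
      exact absurd (Nat.le_of_dvd h0 h2) (by omega)
    simp only [Set.mem_insert_iff, Set.mem_singleton_iff, not_or]
    refine ⟨fun h => hne (i + 3) (by omega) (by omega) ?_,
      fun h => hne (i + 2) (by omega) (by omega) ?_,
      fun h => hne (i + 1) (by omega) (by omega) ?_⟩ <;> push_cast <;> linear_combination h
  have hclen : c.length = n + 1 := by simp [hc]
  clear_value c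
  rw [hw] at hprod hsum ⊢
  obtain ⟨t, hn, ht⟩ := exists_tree n ((a (k + 1) + 1) :: (c ++ [a (k - 1) + 1]))
    (by simp [hclen])
    (by
      intro x hx
      simp only [List.mem_append, List.mem_cons, List.not_mem_nil, or_false] at hx
      rcases hx with rfl | hx | rfl
      · omega
      · exact hcpos x hx
      · omega)
    (by
      have h1 : M (a (k - 1)) * (M (-1) * (M (a (k + 1)) * mprod c)) = 1 := by
        rw [mul_eq_one_comm]
        simpa [mul_assoc] using hprod
      rw [← mul_assoc (M (-1)), ← mul_assoc, ← mul_assoc (M (a (k - 1))), prod_neg_one,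
        neg_mul, neg_eq_iff_eq_neg, mul_assoc] at h1
      have h2 := mul_comm_of_sq_one (Or.inr rfl) h1
      simpa [mul_assoc] using h2)
    (by
      simp at hsum ⊢
      linarith)
  refine ⟨t, by omega, ?_⟩
  simp only [List.cons.injEq] at ht
  obtain ⟨h1, h2⟩ := ht
  obtain ⟨h2, h3⟩ := List.append_inj' h2 rfl
  simp at h3
  simp [blowup, h1, h2, h3]

end Quiddity

open Quiddity BinaryTree in
theorem stmt19 (N : ℕ) [NeZero N] (hN : 4 ≤ N) :
    Set.ncard {a : ZMod N → ℤ |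
        ((List.range N).map fun i => M (a (i : ZMod N))).prod = 1 ∧
        (∑ i, a i) = 3 * (N : ℤ) - 12 ∧
        ∃ k : ZMod N, a k = -1 ∧ 0 ≤ a (k - 1) ∧ 0 ≤ a (k + 1) ∧
          ∀ i : ZMod N, i ∉ ({k - 1, k, k + 1} : Set (ZMod N)) → 1 ≤ a i}
      = N * catalan (N - 3) := by
  have hprod : ∀ a : ZMod N → ℤ,
      ((List.range N).map fun i => M (a (i : ZMod N))).prod = mprod (window a 0) := by
    intro a
    simp [mprod, window, Function.comp_def, ← List.map_eq_flatMap]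
  have hset : {a : ZMod N → ℤ |
        ((List.range N).map fun i => M (a (i : ZMod N))).prod = 1 ∧
        (∑ i, a i) = 3 * (N : ℤ) - 12 ∧
        ∃ k : ZMod N, a k = -1 ∧ 0 ≤ a (k - 1) ∧ 0 ≤ a (k + 1) ∧
          ∀ i : ZMod N, i ∉ ({k - 1, k, k + 1} : Set (ZMod N)) → 1 ≤ a i} =
      (fun p : ZMod N × BinaryTree Unit => sol N p.1 p.2) ''
        ((Finset.univ ×ˢ treesOfNumNodesEq (N - 3) : Finset (ZMod N × BinaryTree Unit)) :
          Set (ZMod N × BinaryTree Unit)) := by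
    ext a
    simp only [Set.mem_ofPred_eq, Set.mem_image, Finset.mem_coe, Finset.mem_product,
      Finset.mem_univ, true_and, mem_treesOfNumNodesEq, Prod.exists, hprod]
    constructor
    · rintro ⟨h1, h2, k, hk, hl, hr, hpos⟩
      obtain ⟨t, ht, hw⟩ := exists_blowup_eq_window hN (mprod_window a 0 k h1)
        ((sum_window a k).trans h2) hk hl hr hpos
      exact ⟨k, t, by omega, (eq_sol hw).symm⟩
    · rintro ⟨k, t, ht, rfl⟩
      have ht' : t.numNodes + 3 = N := by omega
      refine ⟨mprod_window _ k 0 ?_, ?_, k, sol_self, ?_, ?_, fun i hi => one_le_sol ht' hi⟩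
      · rw [window_sol k ht', mprod_blowup]
      · rw [← sum_window _ k, window_sol k ht', sum_blowup, ← ht']
        push_cast; ring
      · rw [sol_sub_one ht']
        have := one_le_lst (t := t) (by omega)
        omega
      · rw [sol_add_one ht']
        have := one_le_fst (t := t) (by omega)
        omega
  rw [hset, Set.InjOn.ncard_image, Set.ncard_coe_finset, Finset.card_product,
    treesOfNumNodesEq_card_eq_catalan, Finset.card_univ, ZMod.card]
  rintro ⟨k, t⟩ h ⟨k', t'⟩ h' (e : sol N k t = sol N k' t')
  simp only [Finset.mem_coe, Finset.mem_product, mem_treesOfNumNodesEq] at h h'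
  have ht : t.numNodes + 3 = N := by omega
  have ht' : t'.numNodes + 3 = N := by omega
  obtain rfl : k = k' := by
    by_contra hne
    have := sol_nonneg hN ht' hne
    rw [← e, sol_self] at this
    omega
  have hb : blowup t = blowup t' := by rw [← window_sol k ht, e, window_sol k ht']
  simp only [blowup, List.cons.injEq, true_and] at hb
  obtain ⟨h1, h2⟩ := hb
  obtain ⟨h2, h3⟩ := List.append_inj' h2 rfl
  simp at h3
  rw [quiddity_injective (by omega) h2 h3]
end
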